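/- arXiv:1711.08669 — 8 statements merged into one kernel-verified Lean document; each statement's English description precedes it below -/
import Mathlib

section
/- Let A be a prime ring and let T = A*G be a crossed product of A by a finite group G. Suppose that the action of G on A is X-outer, i.e. for every non-identity g in G the induced automorphism of A is not given by conjugation by an element of the symmetric Martindale ring of quotients Q_s(A). Then the centre of A*G equals Z(A)^G, the subring of the centre Z(A) of A fixed by the induced action of G. -/
/-- A (possibly noncommutative) ring is *prime* if `a R b = 0` implies `a = 0` or `b = 0`. -/
def IsPrimeRing (R : Type*) [Ring R] : Prop :=
  ∀ a b : R, (∀ x : R, a * x * b = 0) → a = 0 ∨ b = 0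

/-- `T` together with `ι : A →+* T`, units `j : G → T` and induced automorphisms
`α : G → A ≃+* A` is a crossed product `A * G`. -/
structure IsCrossedProduct (A : Type*) [Ring A] (G : Type*) [Group G] [Fintype G]
    (T : Type*) [Ring T] (ι : A →+* T) (j : G → T) (α : G → A ≃+* A) : Prop where
  injective : Function.Injective ι
  j_one : j 1 = 1
  j_isUnit : ∀ g : G, IsUnit (j g)
  comm : ∀ (g : G) (a : A), j g * ι a = ι (α g a) * j g
  twist : ∀ g h : G, ∃ τ : Aˣ, j g * j h = ι ↑τ * j (g * h)
  basis : ∀ t : T, ∃! c : G → A, t = ∑ g : G, ι (c g) * j g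

/-- `f : R →+* Q` exhibits `Q` as the symmetric Martindale ring of quotients of
the prime ring `R`. -/
structure IsSymmetricMartindaleQuotient (R Q : Type*) [Ring R] [Ring Q] (f : R →+* Q) :
    Prop where
  injective : Function.Injective f
  exists_ideals : ∀ q : Q, ∃ I J : TwoSidedIdeal R,
    (∃ x ∈ I, x ≠ (0 : R)) ∧ (∃ x ∈ J, x ≠ (0 : R)) ∧
    (∀ a ∈ I, f a * q ∈ Set.range f) ∧ (∀ b ∈ J, q * f b ∈ Set.range f)
  eq_zero : ∀ q : Q, ∀ I : TwoSidedIdeal R, (∃ x ∈ I, x ≠ (0 : R)) →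
    ((∀ a ∈ I, f a * q = 0) ∨ (∀ a ∈ I, q * f a = 0)) → q = 0
  exists_elem : ∀ I J : TwoSidedIdeal R, (∃ x ∈ I, x ≠ (0 : R)) → (∃ x ∈ J, x ≠ (0 : R)) →
    ∀ F G : R → R,
      (∀ a b : R, a ∈ I → b ∈ I → F (a + b) = F a + F b) →
      (∀ (r : R) (a : R), a ∈ I → F (r * a) = r * F a) →
      (∀ a b : R, a ∈ J → b ∈ J → G (a + b) = G a + G b) →
      (∀ (a : R) (r : R), a ∈ J → G (a * r) = G a * r) →
      (∀ a ∈ I, ∀ b ∈ J, F a * b = a * G b) →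
      ∃ q : Q, (∀ a ∈ I, f (F a) = f a * q) ∧ (∀ b ∈ J, f (G b) = q * f b)

/-- A function `σ : R → R` (typically an automorphism) is *X-inner* with respect to a
symmetric Martindale quotient `f : R →+* Q` if it is conjugation by a unit of `Q`. -/
def IsXInner {R Q : Type*} [Ring R] [Ring Q] (f : R →+* Q) (σ : R → R) : Prop :=
  ∃ q : Qˣ, ∀ a : R, f (σ a) = ↑q * f a * ↑q⁻¹

section TwistedNormalElement

variable {R : Type*} [Ring R] {σ : R ≃+* R} {x : R}

/-- In a prime ring, a nonzero element `x` with `a * x = x * σ a` is right cancellable. -/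
theorem IsPrimeRing.mul_right_injective_of_twisted (hR : IsPrimeRing R)
    (hx : ∀ a, a * x = x * σ a) (hx0 : x ≠ 0) : Function.Injective (fun a => a * x) := by
  intro a b hab
  have h0 : (a - b) * x = 0 := by
    rw [sub_mul, sub_eq_zero]
    exact hab
  refine sub_eq_zero.1 ((hR (a - b) x fun y => ?_).resolve_right hx0)
  rw [mul_assoc, hx, ← mul_assoc, h0, zero_mul]

/-- In a prime ring, a nonzero element `x` with `a * x = x * σ a` is left cancellable. -/
theorem IsPrimeRing.mul_left_injective_of_twisted (hR : IsPrimeRing R)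
    (hx : ∀ a, a * x = x * σ a) (hx0 : x ≠ 0) : Function.Injective (fun a => x * a) := by
  intro a b hab
  have h0 : x * (a - b) = 0 := by
    rw [mul_sub, sub_eq_zero]
    exact hab
  refine sub_eq_zero.1 ((hR x (a - b) fun y => ?_).resolve_left hx0)
  obtain ⟨y, rfl⟩ := σ.surjective y
  rw [← hx, mul_assoc, h0, mul_zero]

/-- The two-sided ideal `R x = x R` generated by an element `x` with `a * x = x * σ a`. -/
def twistedIdeal (hx : ∀ a, a * x = x * σ a) : TwoSidedIdeal R :=
  TwoSidedIdeal.mk' {y | ∃ a, y = a * x}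
    ⟨0, (zero_mul x).symm⟩
    (by
      rintro _ _ ⟨a, rfl⟩ ⟨b, rfl⟩
      exact ⟨a + b, (add_mul a b x).symm⟩)
    (by
      rintro _ ⟨a, rfl⟩
      exact ⟨-a, (neg_mul a x).symm⟩)
    (by
      rintro r _ ⟨a, rfl⟩
      exact ⟨r * a, (mul_assoc r a x).symm⟩)
    (by
      rintro _ r ⟨a, rfl⟩
      refine ⟨a * σ.symm r, ?_⟩
      rw [mul_assoc, mul_assoc, hx (σ.symm r), σ.apply_symm_apply])

theorem mem_twistedIdeal (hx : ∀ a, a * x = x * σ a) {y : R} :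
    y ∈ twistedIdeal hx ↔ ∃ a, y = a * x :=
  TwoSidedIdeal.mem_mk' ..

theorem mem_twistedIdeal_iff_exists_mul_left (hx : ∀ a, a * x = x * σ a) {y : R} :
    y ∈ twistedIdeal hx ↔ ∃ a, y = x * a := by
  rw [mem_twistedIdeal]
  constructor
  · rintro ⟨a, rfl⟩
    exact ⟨σ a, hx a⟩
  · rintro ⟨a, rfl⟩
    exact ⟨σ.symm a, by rw [hx, σ.apply_symm_apply]⟩

/-- An automorphism `σ` of a prime ring is X-inner as soon as some nonzero `x` satisfies
`a * x = x * σ a` for all `a`. -/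
theorem IsPrimeRing.isXInner_of_twisted (hR : IsPrimeRing R) {Q : Type*} [Ring Q] {f : R →+* Q}
    (hQ : IsSymmetricMartindaleQuotient R Q f) (hx : ∀ a, a * x = x * σ a) (hx0 : x ≠ 0) :
    IsXInner f σ := by
  have hF := Function.leftInverse_invFun (hR.mul_right_injective_of_twisted hx hx0)
  have hG := Function.leftInverse_invFun (hR.mul_left_injective_of_twisted hx hx0)
  set F := Function.invFun fun a => a * x
  set G := Function.invFun fun a => x * a
  replace hF : ∀ a, F (a * x) = a := hF
  replace hG : ∀ a, G (x * a) = a := hG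
  have hne : ∃ y ∈ twistedIdeal hx, y ≠ 0 :=
    ⟨x, (mem_twistedIdeal hx).2 ⟨1, (one_mul x).symm⟩, hx0⟩
  obtain ⟨q, hqF, hqG⟩ := hQ.exists_elem (twistedIdeal hx) (twistedIdeal hx) hne hne F G
    (by
      simp only [mem_twistedIdeal]
      rintro _ _ ⟨a, rfl⟩ ⟨b, rfl⟩
      rw [← add_mul, hF, hF, hF])
    (by
      simp only [mem_twistedIdeal]
      rintro r _ ⟨a, rfl⟩
      rw [← mul_assoc, hF, hF])
    (by
      simp only [mem_twistedIdeal_iff_exists_mul_left]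
      rintro _ _ ⟨a, rfl⟩ ⟨b, rfl⟩
      rw [← mul_add, hG, hG, hG])
    (by
      simp only [mem_twistedIdeal_iff_exists_mul_left]
      rintro _ r ⟨a, rfl⟩
      rw [mul_assoc, hG, hG])
    (by
      intro y hy z hz
      obtain ⟨a, rfl⟩ := (mem_twistedIdeal hx).1 hy
      obtain ⟨b, rfl⟩ := (mem_twistedIdeal_iff_exists_mul_left hx).1 hz
      rw [hF, hG, mul_assoc])
  have hq : ∀ b, f b = q * f (x * b) := fun b => by
    simpa only [hG] using hqG (x * b) ((mem_twistedIdeal_iff_exists_mul_left hx).2 ⟨b, rfl⟩)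
  have hqx : q * f x = 1 := by simpa using (hq 1).symm
  have hxq : f x * q = 1 := by
    have h := hqF (1 * x) ((mem_twistedIdeal hx).2 ⟨1, rfl⟩)
    rw [hF] at h
    simpa using h.symm
  refine ⟨⟨q, f x, hqx, hxq⟩, fun a => ?_⟩
  change f (σ a) = q * f a * f x
  rw [hq, ← hx, map_mul, mul_assoc]

end TwistedNormalElement

namespace IsCrossedProduct

variable {A : Type*} [Ring A] {G : Type*} [Group G] [Fintype G] {T : Type*} [Ring T]
  {ι : A →+* T} {j : G → T} {α : G → A ≃+* A}

theorem sum_injective (hT : IsCrossedProduct A G T ι j α) {c d : G → A}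
    (h : ∑ g, ι (c g) * j g = ∑ g, ι (d g) * j g) : c = d :=
  (hT.basis _).unique rfl h

/-- The coefficients of an element commuting with `A` are twisted by the action. -/
theorem mul_coeff_eq (hT : IsCrossedProduct A G T ι j α) {c : G → A} {a : A}
    (h : ι a * ∑ g, ι (c g) * j g = (∑ g, ι (c g) * j g) * ι a) (g : G) :
    a * c g = c g * α g a := by
  refine congrFun (hT.sum_injective (c := fun g => a * c g) (d := fun g => c g * α g a) ?_) g
  simpa only [Finset.mul_sum, Finset.sum_mul, map_mul, mul_assoc, hT.comm] using h

end IsCrossedProduct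

/-- The centre of a crossed product `A * G` with an X-outer action of a finite group `G`
on a prime ring `A` equals `Z(A)^G`. -/
theorem crossedProduct_center_eq_fixed_of_XOuter
    (A : Type*) [Ring A] (hA : IsPrimeRing A)
    (G : Type*) [Group G] [Fintype G]
    (T : Type*) [Ring T] (iota : A →+* T) (j : G → T) (alpha : G → A ≃+* A)
    (hT : IsCrossedProduct A G T iota j alpha)
    (Qs : Type*) [Ring Qs] (f : A →+* Qs)
    (hQs : IsSymmetricMartindaleQuotient A Qs f)
    (houter : ∀ g : G, g ≠ 1 → ¬ IsXInner f (alpha g)) :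
    ∀ t : T, t ∈ Subring.center T ↔
      ∃ a : A, a ∈ Subring.center A ∧ (∀ g : G, alpha g a = a) ∧ t = iota a := by
  intro t
  rw [Subring.mem_center_iff]
  constructor
  · intro ht
    obtain ⟨c, hc, -⟩ := hT.basis t
    have htw : ∀ g a, a * c g = c g * alpha g a := fun g a =>
      hT.mul_coeff_eq (by rw [← hc]; exact ht (iota a)) g
    have hc0 : ∀ g, g ≠ 1 → c g = 0 := fun g hg => by
      by_contra h
      exact houter g hg (hA.isXInner_of_twisted hQs (htw g) h)
    have ht1 : t = iota (c 1) := by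
      rw [hc, Finset.sum_eq_single 1 (fun g _ hg => by rw [hc0 g hg, map_zero, zero_mul])
        (fun h => absurd (Finset.mem_univ _) h), hT.j_one, mul_one]
    refine ⟨c 1, ?_, fun g => ?_, ht1⟩
    · rw [Subring.mem_center_iff]
      intro a
      apply hT.injective
      rw [map_mul, map_mul, ← ht1]
      exact ht _
    · apply hT.injective
      apply (hT.j_isUnit g).mul_right_cancel
      rw [← hT.comm, ← ht1]
      exact ht _
  · rintro ⟨a, ha, hfix, rfl⟩ s
    rw [Subring.mem_center_iff] at ha
    obtain ⟨c, rfl, -⟩ := hT.basis s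
    rw [Finset.sum_mul, Finset.mul_sum]
    refine Finset.sum_congr rfl fun g _ => ?_
    rw [mul_assoc, hT.comm, hfix, ← mul_assoc, ← mul_assoc, ← map_mul, ha, map_mul]
end

section
/- Let k be an algebraically closed field of characteristic zero, let R be a commutative finitely generated k-algebra which is a domain, and let G be a finite group acting k-linearly and freely on R, meaning that the stabiliser of every maximal ideal of R is trivial. Then for every maximal ideal m of the invariant ring R^G, the extension mR is a G-maximal ideal of R, i.e. mR is a proper G-stable ideal of R which is maximal among proper G-stable ideals of R. -/
/-- The fixed subring `R^G` of a (semi)group action by ring automorphisms. -/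
def fixedSubring (G : Type*) [Monoid G] (R : Type*) [Ring R] [MulSemiringAction G R] :
    Subring R where
  carrier := {x | ∀ g : G, g • x = x}
  mul_mem' := by intro a b ha hb; intro g; rw [smul_mul', ha g, hb g]
  one_mem' := by intro g; exact smul_one g
  add_mem' := by intro a b ha hb; intro g; rw [smul_add, ha g, hb g]
  zero_mem' := by intro g; exact smul_zero g
  neg_mem' := by intro a ha; intro g; rw [smul_neg, ha g]

section FreeAction

variable {G R : Type*} [Group G] [CommRing R] [MulSemiringAction G R]

/-- The ring homomorphism sending `y` to the function `h ↦ h • y` on the group. -/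
def orbitHom (G R : Type*) [Group G] [CommRing R] [MulSemiringAction G R] : R →+* (G → R) :=
  RingHom.pi fun h => MulSemiringAction.toRingHom G R h

@[simp]
theorem orbitHom_apply (y : R) (h : G) : orbitHom G R y h = h • y := rfl

/-- The `R`-subalgebra of functions on `G` generated by the orbit functions `h ↦ h • y`. -/
def orbitAlgebra (G R : Type*) [Group G] [CommRing R] [MulSemiringAction G R] :
    Subalgebra R (G → R) :=
  Algebra.adjoin R (Set.range (orbitHom G R))

theorem toSubmodule_orbitAlgebra :
    Subalgebra.toSubmodule (orbitAlgebra G R) = Submodule.span R (Set.range (orbitHom G R)) := by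
  have h : (Submonoid.closure (Set.range (orbitHom G R)) : Set (G → R)) =
      Set.range (orbitHom G R) := by
    have := Submonoid.closure_eq (MonoidHom.mrange (orbitHom G R : R →* (G → R)))
    exact congrArg (fun S : Submonoid (G → R) => (S : Set (G → R))) this
  rw [orbitAlgebra, Algebra.adjoin_eq_span, h]

/-- If no maximal ideal is stable under `g`, the elements `b - g • b` generate the unit ideal. -/
theorem span_sub_smul_eq_top {g : G}
    (hg : ∀ m : Ideal R, m.IsMaximal → ∃ x ∈ m, g • x ∉ m) :
    Ideal.span (Set.range fun b : R => b - g • b) = ⊤ := by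
  by_contra h
  obtain ⟨m, hm, hle⟩ := Ideal.exists_le_maximal _ h
  obtain ⟨x, hx, hgx⟩ := hg m hm
  have hsub : x - g • x ∈ m := hle (Ideal.subset_span ⟨x, rfl⟩)
  exact hgx ((Submodule.sub_mem_iff_right m hx).mp hsub)

theorem exists_mem_orbitAlgebra_of_mem_span {g : G} {c : R}
    (hc : c ∈ Ideal.span (Set.range fun b : R => b - g • b)) :
    ∃ e ∈ orbitAlgebra G R, e 1 = c ∧ e g = 0 := by
  induction hc using Submodule.span_induction with
  | mem x hx =>
    obtain ⟨b, rfl⟩ := hx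
    refine ⟨orbitHom G R b - algebraMap R (G → R) (g • b), ?_, ?_, ?_⟩
    · exact sub_mem (Algebra.subset_adjoin ⟨b, rfl⟩) (Subalgebra.algebraMap_mem _ _)
    · simp
    · simp
  | zero => exact ⟨0, zero_mem _, rfl, rfl⟩
  | add x y _ _ hx hy =>
    obtain ⟨e, he, rfl, he0⟩ := hx
    obtain ⟨f, hf, rfl, hf0⟩ := hy
    exact ⟨e + f, add_mem he hf, rfl, by simp [he0, hf0]⟩
  | smul a x _ hx =>
    obtain ⟨e, he, rfl, he0⟩ := hx
    exact ⟨a • e, Subalgebra.smul_mem _ he a, rfl, by simp [he0]⟩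

/-- For a free action, the indicator function of `1` is a combination of orbit functions. -/
theorem exists_mem_orbitAlgebra_indicator [Fintype G]
    (hfree : ∀ m : Ideal R, m.IsMaximal → ∀ g : G, g ≠ 1 → ∃ x ∈ m, g • x ∉ m) :
    ∃ e ∈ orbitAlgebra G R, e 1 = 1 ∧ ∀ g : G, g ≠ 1 → e g = 0 := by
  classical
  have key (g : G) : ∃ e ∈ orbitAlgebra G R, e 1 = 1 ∧ (g ≠ 1 → e g = 0) := by
    by_cases hg : g = 1
    · exact ⟨1, one_mem _, rfl, fun h => absurd hg h⟩
    · obtain ⟨e, he, he1, he0⟩ := exists_mem_orbitAlgebra_of_mem_span (g := g) (c := (1 : R))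
        (by rw [span_sub_smul_eq_top fun m hm => hfree m hm g hg]; trivial)
      exact ⟨e, he, he1, fun _ => he0⟩
  choose e he he1 he0 using key
  refine ⟨∏ g, e g, prod_mem fun g _ => he g, ?_, fun g hg => ?_⟩
  · simp [Finset.prod_apply, he1]
  · rw [Finset.prod_apply]
    exact Finset.prod_eq_zero (Finset.mem_univ g) (he0 g hg)

/-- The sum of the translates of an element, as an element of the fixed subring. -/
def fixedTrace [Fintype G] (x : R) : fixedSubring G R :=
  ⟨∑ h : G, h • x, fun g => by
    simp only [Finset.smul_sum, smul_smul]
    exact Fintype.sum_equiv (Equiv.mulLeft g) _ _ fun _ => rfl⟩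

theorem fixedTrace_add [Fintype G] (x y : R) :
    fixedTrace (G := G) (x + y) = fixedTrace x + fixedTrace y :=
  Subtype.ext (by simp [fixedTrace, Finset.sum_add_distrib])

theorem fixedTrace_zero [Fintype G] : fixedTrace (G := G) (0 : R) = 0 :=
  Subtype.ext (by simp [fixedTrace])

theorem fixedTrace_mul_coe [Fintype G] (r : R) (a : fixedSubring G R) :
    fixedTrace (r * a) = fixedTrace r * a :=
  Subtype.ext (by simp [fixedTrace, Finset.sum_mul, smul_mul', a.2 _])

theorem fixedTrace_one [Fintype G] :
    fixedTrace (G := G) (1 : R) = (Fintype.card G : fixedSubring G R) :=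
  Subtype.ext (by simp [fixedTrace])

theorem fixedTrace_mem_of_mem_map [Fintype G] {m : Ideal (fixedSubring G R)} {x : R}
    (hx : x ∈ m.map (fixedSubring G R).subtype) : fixedTrace x ∈ m := by
  rw [Ideal.map] at hx
  -- the trace is additive but only linear over the invariants, so scalars stay in the hypothesis
  suffices ∀ r : R, fixedTrace (r * x) ∈ m by simpa using this 1
  induction hx using Submodule.span_induction with
  | mem x hx =>
    obtain ⟨a, ha, rfl⟩ := hx
    intro r
    rw [Subring.subtype_apply, fixedTrace_mul_coe]
    exact m.mul_mem_left _ ha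
  | zero => intro r; rw [mul_zero, fixedTrace_zero]; exact m.zero_mem
  | add x y _ _ hx hy => intro r; rw [mul_add, fixedTrace_add]; exact m.add_mem (hx r) (hy r)
  | smul a x _ hx => intro r; rw [smul_eq_mul, ← mul_assoc]; exact hx _

theorem smul_mem_map_fixedSubring (m : Ideal (fixedSubring G R)) (g : G) {x : R}
    (hx : x ∈ m.map (fixedSubring G R).subtype) :
    g • x ∈ m.map (fixedSubring G R).subtype := by
  have hle : m.map (fixedSubring G R).subtype ≤
      (m.map (fixedSubring G R).subtype).comap (MulSemiringAction.toRingHom G R g) := by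
    rw [Ideal.map_le_iff_le_comap]
    intro a ha
    have hga : g • (a : R) = a := a.2 g
    simpa [Ideal.mem_comap, hga] using Ideal.mem_map_of_mem (fixedSubring G R).subtype ha
  exact hle hx

theorem isUnit_card_fixedSubring (k : Type*) [Field k] [CharZero k] [Algebra k R]
    [SMulCommClass G k R] [Fintype G] : IsUnit (Fintype.card G : fixedSubring G R) := by
  have hcard : (Fintype.card G : k) ≠ 0 := Nat.cast_ne_zero.mpr Fintype.card_ne_zero
  refine IsUnit.of_mul_eq_one
    ⟨(Fintype.card G : k)⁻¹ • (1 : R), fun g => by rw [smul_comm, smul_one]⟩ (Subtype.ext ?_)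
  have : algebraMap k R (Fintype.card G) * algebraMap k R (Fintype.card G : k)⁻¹ = 1 := by
    rw [← map_mul, mul_inv_cancel₀ hcard, map_one]
  simpa [Algebra.smul_def] using this

/-- A stable ideal of a free action is generated by its invariant elements. -/
theorem mem_map_of_mem_of_free [Fintype G]
    (hfree : ∀ m : Ideal R, m.IsMaximal → ∀ g : G, g ≠ 1 → ∃ x ∈ m, g • x ∉ m)
    {J : Ideal R} (hJ : ∀ (g : G), ∀ x ∈ J, g • x ∈ J) {z : R} (hz : z ∈ J) :
    z ∈ (J.comap (fixedSubring G R).subtype).map (fixedSubring G R).subtype := by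
  obtain ⟨e, he, he1, he0⟩ := exists_mem_orbitAlgebra_indicator hfree
  have key : ∑ h : G, e h * h • z ∈
      (J.comap (fixedSubring G R).subtype).map (fixedSubring G R).subtype := by
    rw [← Subalgebra.mem_toSubmodule, toSubmodule_orbitAlgebra] at he
    clear he1 he0
    induction he using Submodule.span_induction with
    | mem e he =>
      obtain ⟨y, rfl⟩ := he
      have hmem : fixedTrace (G := G) (y * z) ∈ J.comap (fixedSubring G R).subtype :=
        J.sum_mem fun h _ => hJ h _ (J.mul_mem_left y hz)
      simpa [fixedTrace, smul_mul'] using Ideal.mem_map_of_mem (fixedSubring G R).subtype hmem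
    | zero => simp
    | add e f _ _ he hf => simpa [add_mul, Finset.sum_add_distrib] using add_mem he hf
    | smul a e _ he => simpa [mul_assoc, Finset.mul_sum] using Ideal.mul_mem_left _ a he
  rwa [Fintype.sum_eq_single 1 fun g hg => by rw [he0 g hg, zero_mul], he1, one_smul,
    one_mul] at key

end FreeAction

/-- If a finite group `G` acts `k`-linearly and freely on a commutative finitely generated
`k`-algebra domain `R`, then for every maximal ideal `m` of `R^G` the extension `m R` is a
`G`-maximal ideal of `R`. -/
theorem extension_of_maximal_isGMaximal
    (k : Type*) [Field k] [IsAlgClosed k] [CharZero k]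
    (R : Type*) [CommRing R] [IsDomain R] [Algebra k R]
    (hfg : Algebra.FiniteType k R)
    (G : Type*) [Group G] [Finite G] [MulSemiringAction G R] [SMulCommClass G k R]
    (hfree : ∀ m : Ideal R, m.IsMaximal → ∀ g : G, g ≠ 1 → ∃ x ∈ m, g • x ∉ m)
    (m : Ideal ↥(fixedSubring G R)) (hm : m.IsMaximal) :
    Ideal.map (fixedSubring G R).subtype m ≠ ⊤ ∧
    (∀ (g : G), ∀ x ∈ Ideal.map (fixedSubring G R).subtype m,
      g • x ∈ Ideal.map (fixedSubring G R).subtype m) ∧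
    (∀ J : Ideal R, J ≠ ⊤ → (∀ (g : G), ∀ x ∈ J, g • x ∈ J) →
      Ideal.map (fixedSubring G R).subtype m ≤ J →
      J = Ideal.map (fixedSubring G R).subtype m) := by
  have := Fintype.ofFinite G
  refine ⟨fun htop => ?_, fun g x hx => smul_mem_map_fixedSubring m g hx, fun J hJ hstab hle => ?_⟩
  · have hmem := fixedTrace_mem_of_mem_map (htop ▸ Submodule.mem_top :
      (1 : R) ∈ m.map (fixedSubring G R).subtype)
    rw [fixedTrace_one] at hmem
    exact hm.ne_top (m.eq_top_of_isUnit_mem hmem (isUnit_card_fixedSubring k))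
  · have hcomap : m = J.comap (fixedSubring G R).subtype :=
      hm.eq_of_le (Ideal.comap_ne_top _ hJ) (Ideal.map_le_iff_le_comap.mp hle)
    refine le_antisymm (fun z hz => ?_) hle
    rw [hcomap]
    exact mem_map_of_mem_of_free hfree hstab hz
end

section
/- Let A be a ring and let G = ⟨g⟩ be a cyclic group of order n acting on A by inner automorphisms: there exists a unit η ∈ A with η^n ∈ Z(A) such that g^i · a = η^i a η^{−i} for all a ∈ A and all i. Then the centre of the skew group ring A # G equals Z(A)[(η^{−1}g)^{±1}], the subring generated by Z(A) together with the central unit η^{−1}g and its inverse. -/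
/-- `T` together with `ι : A →+* T` and `j : G → T` is the skew group ring `A # G`
for the action of the finite group `G` on `A`. -/
structure IsSkewGroupRing (A : Type*) [Ring A] (G : Type*) [Group G] [Fintype G]
    [MulSemiringAction G A] (T : Type*) [Ring T] (ι : A →+* T) (j : G → T) : Prop where
  injective : Function.Injective ι
  j_one : j 1 = 1
  j_mul : ∀ g h : G, j g * j h = j (g * h)
  comm : ∀ (g : G) (a : A), j g * ι a = ι (g • a) * j g
  basis : ∀ t : T, ∃! c : G → A, t = ∑ g : G, ι (c g) * j g

theorem IsSkewGroupRing.mem_center {A : Type*} [Ring A] {G : Type*} [Group G] [Fintype G]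
    [MulSemiringAction G A] {T : Type*} [Ring T] {ι : A →+* T} {j : G → T}
    (hT : IsSkewGroupRing A G T ι j) {x : T}
    (hι : ∀ a, Commute (ι a) x) (hj : ∀ h, Commute (j h) x) : x ∈ Subring.center T := by
  rw [Subring.mem_center_iff]
  intro t
  obtain ⟨c, rfl, -⟩ := hT.basis t
  exact Commute.sum_left _ _ _ fun h _ => (hι _).mul_left (hj h)

theorem IsSkewGroupRing.j_pow {A : Type*} [Ring A] {G : Type*} [Group G] [Fintype G]
    [MulSemiringAction G A] {T : Type*} [Ring T] {ι : A →+* T} {j : G → T}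
    (hT : IsSkewGroupRing A G T ι j) (g : G) (i : ℕ) : j (g ^ i) = j g ^ i := by
  induction i with
  | zero => simp [hT.j_one]
  | succ k ih => rw [pow_succ, pow_succ, ← hT.j_mul, ih]

/-- The coefficients of an element commuting with the image of `A` are twisted-central. -/
theorem IsSkewGroupRing.mul_coeff_eq {A : Type*} [Ring A] {G : Type*} [Group G] [Fintype G]
    [MulSemiringAction G A] {T : Type*} [Ring T] {ι : A →+* T} {j : G → T}
    (hT : IsSkewGroupRing A G T ι j) {c : G → A} {a : A}
    (hc : Commute (ι a) (∑ h : G, ι (c h) * j h)) (h : G) : a * c h = c h * (h • a) := by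
  have key : ι a * (∑ h : G, ι (c h) * j h) = ∑ h : G, ι (a * c h) * j h := by
    simp [Finset.mul_sum, mul_assoc]
  have key' : ι a * (∑ h : G, ι (c h) * j h) = ∑ h : G, ι (c h * (h • a)) * j h := by
    rw [hc.eq, Finset.sum_mul]
    refine Finset.sum_congr rfl fun h _ => ?_
    rw [mul_assoc, hT.comm, map_mul, mul_assoc]
  exact congrFun ((hT.basis _).unique (y₁ := fun h => a * c h)
    (y₂ := fun h => c h * (h • a)) key key') h

/-- If a cyclic group `G = ⟨g⟩` of order `n` acts on `A` by inner automorphisms via a unit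
`η` with `η^n` central, then `Z(A # G) = Z(A)[(η⁻¹ g)^{±1}]`. -/
theorem center_skewGroupRing_of_inner
    (A : Type*) [Ring A]
    (G : Type*) [Group G] [Fintype G] (g : G) (n : ℕ) (hn : 0 < n)
    (hord : orderOf g = n) (hcyc : ∀ x : G, ∃ i : ℕ, x = g ^ i)
    (eta : Aˣ) (hcen : ((eta : A)) ^ n ∈ Subring.center A)
    [MulSemiringAction G A]
    (hact : ∀ (i : ℕ) (a : A), g ^ i • a = (eta : A) ^ i * a * ((eta⁻¹ : Aˣ) : A) ^ i)
    (T : Type*) [Ring T] (iota : A →+* T) (j : G → T)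
    (hT : IsSkewGroupRing A G T iota j) :
    Subring.center T =
      Subring.closure ((⇑iota) '' (Subring.center A : Set A) ∪
        {iota ((eta⁻¹ : Aˣ) : A) * j g, j g⁻¹ * iota (eta : A)}) := by
  have hg (a : A) : g • a = eta * a * ((eta⁻¹ : Aˣ) : A) := by simpa using hact 1 a
  have hjeta : Commute (j g) (iota ((eta⁻¹ : Aˣ) : A)) := by
    rw [Commute, SemiconjBy, hT.comm, hg]
    simp
  have hu : iota ((eta⁻¹ : Aˣ) : A) * j g ∈ Subring.center T := by
    refine hT.mem_center (fun a => ?_) fun h => ?_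
    · rw [Commute, SemiconjBy, mul_assoc, hT.comm, hg, ← mul_assoc, ← mul_assoc, ← map_mul,
        ← map_mul]
      simp [mul_assoc]
    · obtain ⟨i, rfl⟩ := hcyc h
      rw [hT.j_pow]
      exact (hjeta.mul_right (Commute.refl _)).pow_left i
  have hvu : j g⁻¹ * iota (eta : A) * (iota ((eta⁻¹ : Aˣ) : A) * j g) = 1 := by
    rw [mul_assoc, ← mul_assoc (iota _) (iota _), ← map_mul]
    simp [hT.j_mul, hT.j_one]
  apply le_antisymm
  · intro t ht
    rw [Subring.mem_center_iff] at ht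
    obtain ⟨c, rfl, -⟩ := hT.basis t
    refine Subring.sum_mem _ fun h _ => ?_
    have hc (a : A) := hT.mul_coeff_eq (a := a) (ht (iota a)) h
    obtain ⟨i, hi⟩ := hcyc h
    have hd : c h * (eta : A) ^ i ∈ Subring.center A := by
      rw [Subring.mem_center_iff]
      intro a
      have hinv : ((eta⁻¹ : Aˣ) : A) ^ i * (eta : A) ^ i = 1 := by
        rw [← Units.val_pow_eq_pow_val, ← Units.val_pow_eq_pow_val, ← Units.val_mul]
        simp
      rw [← mul_assoc, hc, hi, hact]
      simp only [mul_assoc, hinv, mul_one]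
    have hterm : iota (c h) * j h =
        iota (c h * (eta : A) ^ i) * (iota ((eta⁻¹ : Aˣ) : A) * j g) ^ i := by
      have hinv : (eta : A) ^ i * ((eta⁻¹ : Aˣ) : A) ^ i = 1 := by
        rw [← Units.val_pow_eq_pow_val, ← Units.val_pow_eq_pow_val, ← Units.val_mul]
        simp
      rw [hjeta.symm.mul_pow, ← map_pow, ← mul_assoc, ← map_mul, mul_assoc (c h), hinv, mul_one,
        ← hT.j_pow, ← hi]
    rw [hterm]
    refine Subring.mul_mem _ (Subring.subset_closure (Or.inl ⟨_, hd, rfl⟩)) (Subring.pow_mem _ ?_ i)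
    exact Subring.subset_closure (Or.inr (Or.inl rfl))
  · rw [Subring.closure_le]
    rintro _ (⟨z, hz, rfl⟩ | rfl | rfl)
    · have hz' := Subring.mem_center_iff.1 hz
      refine hT.mem_center (fun a => ?_) fun h => ?_
      · rw [Commute, SemiconjBy, ← map_mul, ← map_mul, hz']
      · obtain ⟨i, rfl⟩ := hcyc h
        have hfix : g ^ i • z = z := by
          rw [hact, hz', mul_assoc, ← Units.val_pow_eq_pow_val, ← Units.val_pow_eq_pow_val,
            ← Units.val_mul]
          simp
        rw [Commute, SemiconjBy, hT.comm, hfix]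
    · exact hu
    · have hu' := Subring.mem_center_iff.1 hu
      refine Subring.mem_center_iff.2 fun t => ?_
      exact (Commute.units_inv_right (u := ⟨_, _, (hu' _).symm.trans hvu, hvu⟩) (hu' t)).eq
end

section
/- Let k be an algebraically closed field of characteristic zero, let A be a prime finitely generated k-algebra, and let G = ⟨g⟩ be a cyclic group of order n acting on A by inner automorphisms: there exists a unit η ∈ A with g^i · a = η^i a η^{−i} for all a ∈ A. Suppose also that the skew group ring T = A # G is prime. Then A is an Azumaya algebra if and only if T is an Azumaya algebra, and in this case A and T have the same rank over their respective centres. -/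
/-- The natural map `A ⊗_{Z(A)} Aᵐᵒᵖ →ₗ End_{Z(A)}(A)`, `a ⊗ b ↦ (r ↦ a * r * b)`. -/
noncomputable def azumayaMulMap (A : Type*) [Ring A] :
    TensorProduct (Subring.center A) A Aᵐᵒᵖ →ₗ[Subring.center A]
      (A →ₗ[Subring.center A] A) :=
  TensorProduct.lift (LinearMap.mk₂ (Subring.center A)
    (fun a b =>
      { toFun := fun r => a * r * b.unop
        map_add' := fun x y => by simp [mul_add, add_mul]
        map_smul' := fun z x => by
          have hz := Subring.mem_center_iff.mp z.2
          show a * ((z : A) * x) * b.unop = (z : A) * (a * x * b.unop)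
          simp only [← mul_assoc]
          rw [hz a] })
    (fun a a' b => by ext r; simp [add_mul])
    (fun z a b => by
      ext r
      have hz := Subring.mem_center_iff.mp z.2
      show ((z : A) * a) * r * b.unop = (z : A) * (a * r * b.unop)
      simp [mul_assoc])
    (fun a b b' => by ext r; simp [mul_add])
    (fun z a b => by
      ext r
      have hz := Subring.mem_center_iff.mp z.2
      show a * r * ((z : A) • b).unop = (z : A) * (a * r * b.unop)
      rw [MulOpposite.unop_smul]
      show a * r * ((z : A) * b.unop) = (z : A) * (a * r * b.unop)
      rw [← mul_assoc, hz (a * r), mul_assoc]))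

/-- A ring is an *Azumaya algebra* (over its centre `Z`) if it is a finitely generated
projective `Z`-module and the natural map `A ⊗_Z Aᵐᵒᵖ → End_Z(A)` is bijective. -/
def IsAzumayaAlgebra (A : Type*) [Ring A] : Prop :=
  Module.Finite (Subring.center A) A ∧ Module.Projective (Subring.center A) A ∧
    Function.Bijective (azumayaMulMap A)

/-- `A` has rank `r` over its centre: for every maximal ideal `m` of `Z = Z(A)`,
`dim_{Z/m} (A / mA) = r`. -/
def HasAzumayaRank (A : Type*) [Ring A] (r : ℕ) : Prop :=
  ∀ m : Ideal (Subring.center A), m.IsMaximal →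
    Module.finrank ((Subring.center A) ⧸ m)
      (A ⧸ (m • (⊤ : Submodule (Subring.center A) A))) = r


open scoped TensorProduct

section BaseChange

variable {R S M N I : Type*} [CommRing R] [CommRing S] [Algebra R S]
  [AddCommGroup M] [Module R M] [AddCommGroup N] [Module R N] [Module S N] [IsScalarTower R S N]
  [Fintype I]

/-- The map `(yᵢ)ᵢ ↦ ∑ᵢ bᵢ • ε yᵢ`. -/
def sumSMul (b : I → S) (ε : M →ₗ[R] N) : (I → M) →ₗ[R] N :=
  ∑ i, (LinearMap.lsmul S N (b i)).restrictScalars R ∘ₗ ε ∘ₗ LinearMap.proj i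

@[simp]
lemma sumSMul_apply (b : I → S) (ε : M →ₗ[R] N) (y : I → M) :
    sumSMul b ε y = ∑ i, b i • ε (y i) := by
  simp [sumSMul]

/-- For `S` free over `R` with basis `b`, a linear map `ε : M → N` exhibits `N` as the base change
of `M` if and only if every element of `N` is uniquely of the form `∑ᵢ bᵢ • ε yᵢ`. -/
lemma isBaseChange_iff_bijective_sumSMul (b : Module.Basis I R S) (ε : M →ₗ[R] N) :
    IsBaseChange S ε ↔ Function.Bijective (sumSMul b ε) := by
  classical
  let e : S ⊗[R] M ≃ₗ[R] (I → M) :=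
    TensorProduct.equivFinsuppOfBasisLeft b ≪≫ₗ Finsupp.linearEquivFunOnFinite R M I
  have key : (sumSMul b ε) = TensorProduct.lift
      (((Algebra.linearMap S <| Module.End S (M →ₗ[R] N)).flip ε).restrictScalars R) ∘ₗ
        e.symm.toLinearMap := by
    refine LinearMap.ext fun y => ?_
    have : e.symm y = ∑ i, b i ⊗ₜ y i := by
      simp only [e, LinearEquiv.trans_symm, LinearEquiv.trans_apply,
        TensorProduct.equivFinsuppOfBasisLeft_symm_apply]
      rw [Finsupp.sum_fintype _ _ (by simp)]
      simp
    simp [this]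
  rw [key, LinearMap.coe_comp]
  exact (Function.Bijective.of_comp_iff _ e.symm.bijective).symm

end BaseChange

lemma projective_trans (S : Type*) {R M : Type*} [CommRing R] [CommRing S] [Algebra R S]
    [AddCommGroup M] [Module R M] [Module S M] [IsScalarTower R S M] [Module.Free R S]
    [Module.Projective S M] : Module.Projective R M := by
  obtain ⟨P, _, _, _, i, s, h⟩ := Module.Projective.iff_split.mp ‹Module.Projective S M›
  let : Module R P := Module.compHom P (algebraMap R S)
  have : IsScalarTower R S P := IsScalarTower.of_compHom R S P
  have : Module.Free R P := .trans (S := S)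
  refine Module.Projective.of_split (i.restrictScalars R) (s.restrictScalars R) ?_
  ext x
  exact LinearMap.congr_fun h x

section Transfer

variable {R S A T I : Type*} [CommRing R] [CommRing S] [Algebra R S] [Ring A] [Algebra R A]
  [Ring T] [Algebra R T] [Algebra S T] [IsScalarTower R S T]

lemma finite_iff_of_isBaseChange [Fintype I] [Nonempty I] (b : Module.Basis I R S)
    {M N : Type*} [AddCommGroup M] [Module R M] [AddCommGroup N] [Module R N] [Module S N]
    [IsScalarTower R S N] {ε : M →ₗ[R] N} (h : IsBaseChange S ε) :
    Module.Finite R M ↔ Module.Finite S N := by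
  have : Module.Finite R S := .of_basis b
  refine ⟨fun _ => .equiv h.equiv, fun _ => ?_⟩
  have : Module.Finite R N := .trans S N
  let e := LinearEquiv.ofBijective _ ((isBaseChange_iff_bijective_sumSMul b ε).mp h)
  have i : I := Classical.arbitrary I
  exact .of_surjective (LinearMap.proj i ∘ₗ e.symm.toLinearMap)
    ((Function.surjective_eval i).comp e.symm.surjective)

lemma projective_iff_of_isBaseChange [Fintype I] [Nonempty I] (b : Module.Basis I R S)
    {M N : Type*} [AddCommGroup M] [Module R M] [AddCommGroup N] [Module R N] [Module S N]
    [IsScalarTower R S N] {ε : M →ₗ[R] N} (h : IsBaseChange S ε) :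
    Module.Projective R M ↔ Module.Projective S N := by
  classical
  have : Module.Free R S := .of_basis b
  refine ⟨fun _ => .of_equiv h.equiv, fun _ => ?_⟩
  have : Module.Projective R N := projective_trans S
  let e := LinearEquiv.ofBijective _ ((isBaseChange_iff_bijective_sumSMul b ε).mp h)
  have i : I := Classical.arbitrary I
  refine .of_split (e.toLinearMap ∘ₗ LinearMap.single R (fun _ => M) i)
    (LinearMap.proj i ∘ₗ e.symm.toLinearMap) ?_
  ext x
  simp

/-- The base change of `A ⊗ Aᵐᵒᵖ`. -/
noncomputable def mapTensorOp (S : Type*) {R A T : Type*} [CommRing R] [CommRing S] [Algebra R S]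
    [Ring A] [Algebra R A] [Ring T] [Algebra R T] [Algebra S T] [IsScalarTower R S T]
    (φ : A →ₐ[R] T) : A ⊗[R] Aᵐᵒᵖ →ₗ[R] T ⊗[S] Tᵐᵒᵖ :=
  TensorProduct.lift
    (((TensorProduct.mk S T Tᵐᵒᵖ).restrictScalars₁₂ R R).compl₁₂ φ.toLinearMap
      (AlgHom.op φ).toLinearMap)

@[simp]
lemma mapTensorOp_tmul (φ : A →ₐ[R] T) (a : A) (a' : Aᵐᵒᵖ) :
    mapTensorOp S φ (a ⊗ₜ a') = φ a ⊗ₜ MulOpposite.op (φ a'.unop) := rfl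

lemma isBaseChange_mapTensorOp (φ : A →ₐ[R] T) (h : IsBaseChange S φ.toLinearMap) :
    IsBaseChange S (mapTensorOp S φ) := by
  have hop : IsBaseChange S (AlgHom.op φ).toLinearMap :=
    (IsBaseChange.iff_of_equiv_comm (MulOpposite.opLinearEquiv R) (MulOpposite.opLinearEquiv S)
      (by ext; rfl)).mp h
  refine .of_equiv (TensorProduct.AlgebraTensorModule.distribBaseChange R S A Aᵐᵒᵖ ≪≫ₗ
    TensorProduct.congr h.equiv hop.equiv) fun x => ?_
  induction x with
  | zero => simp
  | add x y hx hy => rw [TensorProduct.tmul_add, map_add, map_add, hx, hy]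
  | tmul a b => simp [IsBaseChange.equiv_tmul]

lemma mulLeftRight_mapTensorOp (φ : A →ₐ[R] T) (x : A ⊗[R] Aᵐᵒᵖ) (a : A) :
    AlgHom.mulLeftRight S T (mapTensorOp S φ x) (φ a) = φ (AlgHom.mulLeftRight R A x a) := by
  induction x with
  | zero => simp
  | add x y hx hy => simp [hx, hy]
  | tmul _ _ => simp

lemma mulLeftRight_bijective_iff_of_isBaseChange [Fintype I] [Nonempty I]
    (b : Module.Basis I R S) (φ : A →ₐ[R] T) (h : IsBaseChange S φ.toLinearMap) :
    Function.Bijective (AlgHom.mulLeftRight R A) ↔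
      Function.Bijective (AlgHom.mulLeftRight S T) := by
  classical
  have hb := (isBaseChange_iff_bijective_sumSMul b _).mp h
  have hb' := (isBaseChange_iff_bijective_sumSMul b _).mp (isBaseChange_mapTensorOp φ h)
  have key (y : I → A ⊗[R] Aᵐᵒᵖ) (a : A) :
      AlgHom.mulLeftRight S T (sumSMul b (mapTensorOp S φ) y) (φ a) =
        sumSMul b φ.toLinearMap fun i => AlgHom.mulLeftRight R A (y i) a := by
    simp [mulLeftRight_mapTensorOp]
  have hext {f f' : Module.End S T} (H : ∀ a, f (φ a) = f' (φ a)) : f = f' :=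
    h.algHom_ext f f' H
  constructor
  · refine fun hA => ⟨(injective_iff_map_eq_zero _).mpr fun x hx => ?_, fun f => ?_⟩
    · obtain ⟨y, rfl⟩ := hb'.2 x
      have hy (i : I) : y i = 0 := by
        refine hA.1 (LinearMap.ext fun a => ?_)
        have := key y a
        rw [hx, LinearMap.zero_apply] at this
        have := congrFun (hb.1 (this.symm.trans (map_zero _).symm)) i
        simpa using this
      rw [funext hy]
      exact map_zero _
    · let e := LinearEquiv.ofBijective _ hb
      choose y hy using fun i => hA.2
        (LinearMap.proj i ∘ₗ e.symm.toLinearMap ∘ₗ f.restrictScalars R ∘ₗ φ.toLinearMap)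
      refine ⟨sumSMul b (mapTensorOp S φ) y, hext fun a => ?_⟩
      rw [key]
      simp only [hy]
      exact e.apply_symm_apply (f (φ a))
  · intro hT
    let i₀ : I := Classical.arbitrary I
    refine ⟨(injective_iff_map_eq_zero _).mpr fun x hx => ?_, fun f => ?_⟩
    · have : sumSMul b (mapTensorOp S φ) (Pi.single i₀ x) = 0 := by
        refine hT.1 (hext fun a => ?_)
        rw [key, map_zero, LinearMap.zero_apply]
        convert map_zero (sumSMul b φ.toLinearMap) with i
        obtain rfl | hi := eq_or_ne i i₀
        · simp [hx]
        · simp [hi]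
      simpa using congrFun (hb'.1 (this.trans (map_zero _).symm)) i₀
    · obtain ⟨x, hx⟩ := hT.2 (b i₀ • h.lift (φ.toLinearMap ∘ₗ f))
      obtain ⟨y, rfl⟩ := hb'.2 x
      refine ⟨y i₀, LinearMap.ext fun a => ?_⟩
      have h1 := key y a
      have h2 : h.lift (φ.toLinearMap ∘ₗ f) (φ a) = φ (f a) := h.lift_eq _ a
      rw [hx, LinearMap.smul_apply, h2] at h1
      have h3 : b i₀ • φ (f a) = sumSMul b φ.toLinearMap (Pi.single i₀ (f a)) := by
        rw [sumSMul_apply, Finset.sum_eq_single i₀ (by simp +contextual) (by simp)]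
        simp
      simpa using (congrFun (hb.1 (h3.symm.trans h1)) i₀).symm

/-- The fibre of a base change at a maximal ideal has the same dimension as the fibre of the
original module at the contracted ideal. -/
lemma finrank_quotient_eq_of_isBaseChange {M N : Type*} [AddCommGroup M] [Module R M]
    [AddCommGroup N] [Module R N] [Module S N] [IsScalarTower R S N] {ε : M →ₗ[R] N}
    (h : IsBaseChange S ε) (P : Ideal R) (Q : Ideal S) [P.IsMaximal] [Q.IsMaximal]
    (hPQ : Q.comap (algebraMap R S) = P) :
    Module.finrank (R ⧸ P) (M ⧸ (P • (⊤ : Submodule R M))) =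
      Module.finrank (S ⧸ Q) (N ⧸ (Q • (⊤ : Submodule S N))) := by
  let : Field (R ⧸ P) := Ideal.Quotient.field P
  let : Field (S ⧸ Q) := Ideal.Quotient.field Q
  let : Algebra (R ⧸ P) (S ⧸ Q) := (Ideal.quotientMap Q (algebraMap R S) hPQ.ge).toAlgebra
  have : IsScalarTower R (R ⧸ P) (S ⧸ Q) := .of_algebraMap_eq fun _ => rfl
  let eM : (R ⧸ P) ⊗[R] M ≃ₗ[R ⧸ P] M ⧸ (P • (⊤ : Submodule R M)) :=
    (TensorProduct.quotTensorEquivQuotSMul M P).extendScalarsOfSurjective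
      Ideal.Quotient.mk_surjective
  let eN : (S ⧸ Q) ⊗[S] N ≃ₗ[S ⧸ Q] N ⧸ (Q • (⊤ : Submodule S N)) :=
    (TensorProduct.quotTensorEquivQuotSMul N Q).extendScalarsOfSurjective
      Ideal.Quotient.mk_surjective
  let e : (S ⧸ Q) ⊗[R ⧸ P] ((R ⧸ P) ⊗[R] M) ≃ₗ[S ⧸ Q] (S ⧸ Q) ⊗[S] N :=
    TensorProduct.AlgebraTensorModule.cancelBaseChange R (R ⧸ P) (S ⧸ Q) (S ⧸ Q) M ≪≫ₗ
      (TensorProduct.AlgebraTensorModule.cancelBaseChange R S (S ⧸ Q) (S ⧸ Q) M).symm ≪≫ₗ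
      LinearEquiv.baseChange S (S ⧸ Q) _ _ h.equiv
  rw [← eM.finrank_eq, ← eN.finrank_eq, ← e.finrank_eq,
    Module.finrank_baseChange (R := S ⧸ Q) (S := R ⧸ P)]

end Transfer

lemma isAzumayaAlgebra_iff (A : Type*) [Ring A] :
    IsAzumayaAlgebra A ↔ Module.Finite (Subring.center A) A ∧
      Module.Projective (Subring.center A) A ∧
        Function.Bijective (AlgHom.mulLeftRight (Subring.center A) A) := by
  have : azumayaMulMap A = (AlgHom.mulLeftRight (Subring.center A) A).toLinearMap := by
    refine TensorProduct.ext' fun a b => LinearMap.ext fun r => ?_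
    simp [azumayaMulMap]
  rw [IsAzumayaAlgebra, this]
  rfl

section CentralBasis

variable {A T I : Type*} [Ring A] [Ring T] [Fintype I]

/-- A ring homomorphism `ι : A → T` such that `T` is free as a right `A`-module on a finite family
of elements of the centre of `T`. -/
structure IsCentralBasis (ι : A →+* T) (w : I → Subring.center T) : Prop where
  bijective : Function.Bijective fun c : I → A => ∑ i, (w i : T) * ι (c i)

namespace IsCentralBasis

variable {ι : A →+* T} {w : I → Subring.center T}

lemma map_mem_center (h : IsCentralBasis ι w) {z : A} (hz : z ∈ Subring.center A) :
    ι z ∈ Subring.center T := by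
  refine Subring.mem_center_iff.mpr fun t => ?_
  obtain ⟨c, rfl⟩ := h.bijective.2 t
  simp only [Finset.sum_mul, Finset.mul_sum]
  refine Finset.sum_congr rfl fun i _ => ?_
  rw [mul_assoc, ← map_mul, Subring.mem_center_iff.mp hz, map_mul, ← mul_assoc, ← mul_assoc,
    Subring.mem_center_iff.mp (w i).2]

/-- The map induced on centres. -/
def centerMap (h : IsCentralBasis ι w) : Subring.center A →+* Subring.center T :=
  (ι.comp (Subring.center A).subtype).codRestrict _ fun z => h.map_mem_center z.2

lemma coordinates_mem_center (h : IsCentralBasis ι w) {c : I → A}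
    (hc : ∑ i, (w i : T) * ι (c i) ∈ Subring.center T) (i : I) : c i ∈ Subring.center A := by
  refine Subring.mem_center_iff.mpr fun a => ?_
  have := Subring.mem_center_iff.mp hc (ι a)
  refine congrFun (h.bijective.1 (a₁ := fun i => a * c i) (a₂ := fun i => c i * a) ?_) i
  simp only [map_mul, ← mul_assoc, ← Finset.sum_mul]
  rw [← this, Finset.mul_sum]
  refine Finset.sum_congr rfl fun i _ => ?_
  rw [← Subring.mem_center_iff.mp (w i).2, mul_assoc]

lemma azumaya_iff_and_rank_iff [Nonempty I] (h : IsCentralBasis ι w)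
    (hι : Function.Injective ι) :
    (IsAzumayaAlgebra A ↔ IsAzumayaAlgebra T) ∧
      ∀ r : ℕ, HasAzumayaRank A r ↔ HasAzumayaRank T r := by
  let : Algebra (Subring.center A) (Subring.center T) := h.centerMap.toAlgebra
  let : Algebra (Subring.center A) T := Algebra.compHom T h.centerMap
  have : IsScalarTower (Subring.center A) (Subring.center T) T := .of_algebraMap_eq fun _ => rfl
  let φ : A →ₐ[Subring.center A] T := { ι with commutes' := fun _ => rfl }
  let f : (I → Subring.center A) →ₗ[Subring.center A] Subring.center T :=
    Fintype.linearCombination _ w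
  have hf (c : I → Subring.center A) : (f c : T) = ∑ i, (w i : T) * ι (c i) := by
    simp only [f, Fintype.linearCombination_apply, AddSubmonoidClass.coe_finsetSum]
    refine Finset.sum_congr rfl fun i _ => ?_
    exact Subring.mem_center_iff.mp (w i).2 (ι (c i))
  have hfbij : Function.Bijective f := by
    refine ⟨fun c c' hcc => funext fun i => Subtype.ext ?_, fun t => ?_⟩
    · have := congrArg (Subtype.val) hcc
      rw [hf, hf] at this
      exact congrFun (h.bijective.1 (a₁ := fun i => c i) (a₂ := fun i => c' i) this) i
    · obtain ⟨c, hc⟩ := h.bijective.2 t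
      have hmem : ∑ i, (w i : T) * ι (c i) ∈ Subring.center T := by
        convert t.2
      refine ⟨fun i => ⟨c i, h.coordinates_mem_center hmem i⟩, Subtype.ext ?_⟩
      rw [hf]
      exact hc
  let b : Module.Basis I (Subring.center A) (Subring.center T) :=
    .ofEquivFun (LinearEquiv.ofBijective f hfbij).symm
  have hb : ⇑b = w := by
    classical
    ext i
    simp [b, f, Fintype.linearCombination_apply_single]
  have hφ : IsBaseChange (Subring.center T) φ.toLinearMap := by
    rw [isBaseChange_iff_bijective_sumSMul b]
    convert h.bijective using 2 with c
    rw [sumSMul_apply, hb]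
    rfl
  refine ⟨?_, fun r => ⟨fun hr Q hQ => ?_, fun hr P hP => ?_⟩⟩
  · rw [isAzumayaAlgebra_iff, isAzumayaAlgebra_iff, finite_iff_of_isBaseChange b hφ,
      projective_iff_of_isBaseChange b hφ, mulLeftRight_bijective_iff_of_isBaseChange b φ hφ]
  all_goals
    have : Module.Finite (Subring.center A) (Subring.center T) := .of_basis b
  · have hP := Ideal.isMaximal_comap_of_isIntegral_of_isMaximal (R := Subring.center A) Q
    rw [← finrank_quotient_eq_of_isBaseChange hφ _ Q rfl]
    exact hr _ hP
  · have hinj : Function.Injective (algebraMap (Subring.center A) (Subring.center T)) :=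
      fun x y hxy => Subtype.ext (hι (congrArg Subtype.val hxy))
    obtain ⟨Q, hQ, hQP⟩ := Ideal.exists_ideal_over_maximal_of_isIntegral
      (S := Subring.center T) P (by simp [(RingHom.injective_iff_ker_eq_bot _).mp hinj])
    rw [finrank_quotient_eq_of_isBaseChange hφ P Q hQP]
    exact hr Q hQ

end IsCentralBasis

end CentralBasis

/-- In a skew group ring for a cyclic group acting by powers of conjugation by `η`, the elements
`η⁻ⁱ gⁱ` form a central basis. -/
lemma IsSkewGroupRing.exists_isCentralBasis {A G T : Type*} [Ring A] [Group G] [Fintype G]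
    [MulSemiringAction G A] [Ring T] {ι : A →+* T} {j : G → T} (hT : IsSkewGroupRing A G T ι j)
    {g : G} (hcyc : ∀ x : G, ∃ i : ℕ, x = g ^ i) (η : Aˣ)
    (hact : ∀ (i : ℕ) (a : A), g ^ i • a = (η : A) ^ i * a * ((η⁻¹ : Aˣ) : A) ^ i) :
    ∃ w : G → Subring.center T, IsCentralBasis ι w := by
  choose e he using hcyc
  let u (x : G) : Aˣ := η ^ e x
  have hu (x : G) (a : A) : x • a = u x * a * ((u x)⁻¹ : Aˣ) := by
    conv_lhs => rw [he x, hact]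
    simp [u]
  have hux (x y : G) : x • (((u y)⁻¹ : Aˣ) : A) = ((u y)⁻¹ : Aˣ) := by
    have hcomm : Commute (u x) (u y)⁻¹ := ((Commute.refl η).pow_pow _ _).inv_right
    rw [hu, ← Units.val_mul, hcomm.eq, Units.val_mul, Units.mul_inv_cancel_right]
  have hG (x y : G) : x * y = y * x := by
    rw [he x, he y, ← pow_add, ← pow_add, add_comm]
  let v (x : G) : T := ι ((u x)⁻¹ : Aˣ) * j x
  have hvι (x : G) (a : A) : v x * ι a = ι (a * ((u x)⁻¹ : Aˣ)) * j x := by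
    rw [mul_assoc, hT.comm, ← mul_assoc, ← map_mul, hu, ← mul_assoc, ← mul_assoc,
      Units.inv_mul, one_mul]
  have hιv (x : G) (a : A) : ι a * v x = v x * ι a := by
    rw [hvι, map_mul, mul_assoc]
  have hjv (x y : G) : j y * v x = v x * j y := by
    rw [← mul_assoc, hT.comm, hux, mul_assoc, mul_assoc, hT.j_mul, hT.j_mul, hG]
  have hv (x : G) : v x ∈ Subring.center T := by
    refine Subring.mem_center_iff.mpr fun t => ?_
    obtain ⟨c, rfl, -⟩ := hT.basis t
    rw [Finset.sum_mul, Finset.mul_sum]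
    refine Finset.sum_congr rfl fun y _ => ?_
    rw [mul_assoc, hjv, ← mul_assoc, hιv, mul_assoc]
  refine ⟨fun x => ⟨v x, hv x⟩, ⟨fun c c' hcc => funext fun x => ?_, fun t => ?_⟩⟩
  · simp only [hvι] at hcc
    have := congrFun ((hT.basis _).unique rfl hcc) x
    exact (Units.mul_left_inj _).mp this
  · obtain ⟨c, hc, -⟩ := hT.basis t
    refine ⟨fun x => c x * u x, ?_⟩
    simp only [hvι, Units.mul_inv_cancel_right]
    exact hc.symm

/-- If a cyclic group acts on a prime finitely generated `k`-algebra `A` by inner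
automorphisms and `T = A # G` is prime, then `A` is Azumaya iff `T` is Azumaya, and
they have the same rank. -/
theorem inner_skewGroupRing_azumaya_iff
    (k : Type*) [Field k] [IsAlgClosed k] [CharZero k]
    (A : Type*) [Ring A] [Algebra k A] (hfg : Algebra.FiniteType k A)
    (hA : IsPrimeRing A)
    (G : Type*) [Group G] [Fintype G] (g : G) (n : ℕ) (hn : 0 < n)
    (hord : orderOf g = n) (hcyc : ∀ x : G, ∃ i : ℕ, x = g ^ i)
    (eta : Aˣ)
    [MulSemiringAction G A]
    (hact : ∀ (i : ℕ) (a : A), g ^ i • a = (eta : A) ^ i * a * ((eta⁻¹ : Aˣ) : A) ^ i)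
    (T : Type*) [Ring T] (iota : A →+* T) (j : G → T)
    (hT : IsSkewGroupRing A G T iota j)
    (hTprime : IsPrimeRing T) :
    (IsAzumayaAlgebra A ↔ IsAzumayaAlgebra T) ∧
    (IsAzumayaAlgebra A → ∀ r : ℕ, HasAzumayaRank A r ↔ HasAzumayaRank T r) := by
  obtain ⟨w, hw⟩ := hT.exists_isCentralBasis hcyc eta hact
  have h := hw.azumaya_iff_and_rank_iff hT.injective
  exact ⟨h.1, fun _ => h.2⟩
end

section
/- Let k be an algebraically closed field of characteristic zero and let R be a prime finitely generated k-algebra which is a finitely generated module over its centre Z (hence a PI ring), of PI degree d. Then R is an Azumaya algebra of rank d² if and only if R/mR is isomorphic to the matrix algebra M_d(k) for every maximal ideal m of Z. -/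
/-- `f : R →+* Q` exhibits `Q` as the (Goldie) classical quotient ring of `R`:
regular elements become units and every element of `Q` is left and a right fraction. -/
structure IsGoldieQuotientRing {R Q : Type*} [Ring R] [Ring Q] (f : R →+* Q) : Prop where
  injective : Function.Injective f
  isUnit_of_regular : ∀ r : R, IsRegular r → IsUnit (f r)
  right_fraction : ∀ q : Q, ∃ a s : R, IsRegular s ∧ q * f s = f a
  left_fraction : ∀ q : Q, ∃ a s : R, IsRegular s ∧ f s * q = f a

open scoped TensorProduct

section Fibres

variable {Z M : Type*} [CommRing Z] [AddCommGroup M] [Module Z M]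

theorem Ideal.exists_one_tmul_eq (m : Ideal Z) (y : (Z ⧸ m) ⊗[Z] M) :
    ∃ x : M, (1 : Z ⧸ m) ⊗ₜ[Z] x = y :=
  TensorProduct.mk_surjective Z M (Z ⧸ m) Ideal.Quotient.mk_surjective y

theorem Ideal.one_tmul_eq_zero_iff (m : Ideal Z) (x : M) :
    (1 : Z ⧸ m) ⊗ₜ[Z] x = 0 ↔ x ∈ m • (⊤ : Submodule Z M) := by
  rw [← (TensorProduct.quotTensorEquivQuotSMul M m).map_eq_zero_iff,
    TensorProduct.quotTensorEquivQuotSMul_mk_one_tmul, Submodule.Quotient.mk_eq_zero]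

theorem Ideal.finrank_quotient_tensor (m : Ideal Z) :
    Module.finrank (Z ⧸ m) ((Z ⧸ m) ⊗[Z] M) =
      Module.finrank (Z ⧸ m) (M ⧸ m • (⊤ : Submodule Z M)) :=
  ((TensorProduct.quotTensorEquivQuotSMul M m).extendScalarsOfSurjective
    Ideal.Quotient.mk_surjective).finrank_eq

theorem Ideal.eq_zero_of_forall_isMaximal_mem [IsReduced Z] [IsJacobsonRing Z] {z : Z}
    (h : ∀ m : Ideal Z, m.IsMaximal → z ∈ m) : z = 0 := by
  have : z ∈ (⊥ : Ideal Z).radical := by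
    rw [Ideal.radical_eq_jacobson, Ideal.jacobson, Ideal.mem_sInf]
    exact fun _ hm ↦ h _ hm.2
  simpa [Ideal.mem_radical_iff] using this

/-- An element of a projective module over a reduced Jacobson ring vanishes as soon as it vanishes
in every closed fibre. -/
theorem Module.Projective.eq_zero_of_forall_one_tmul_eq_zero [IsReduced Z] [IsJacobsonRing Z]
    [Module.Projective Z M] {t : M}
    (h : ∀ m : Ideal Z, m.IsMaximal → (1 : Z ⧸ m) ⊗ₜ[Z] t = 0) : t = 0 := by
  refine (Module.forall_dual_apply_eq_zero_iff Z t).mp fun φ ↦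
    Ideal.eq_zero_of_forall_isMaximal_mem fun m hm ↦ ?_
  have ht := (m.one_tmul_eq_zero_iff t).mp (h m hm)
  have := Submodule.mem_map_of_mem (f := φ) ht
  rw [Submodule.map_smul''] at this
  simpa using Submodule.smul_mono le_rfl le_top this

/-- Near a maximal ideal `m`, a basis of the fibre at `m` lifts to a basis, if all fibres have the
same dimension. -/
theorem Module.exists_linearIndependent_smul_mem_span [IsDomain Z] [IsJacobsonRing Z]
    [Module.Finite Z M] {n : ℕ}
    (h : ∀ m : Ideal Z, m.IsMaximal → Module.finrank (Z ⧸ m) ((Z ⧸ m) ⊗[Z] M) = n)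
    (m : Ideal Z) (hm : m.IsMaximal) :
    ∃ s : Z, s ∉ m ∧ ∃ r : Fin n → M, LinearIndependent Z r ∧
      ∀ x : M, s • x ∈ Submodule.span Z (Set.range r) := by
  let := Ideal.Quotient.field m
  let b := Module.finBasisOfFinrankEq (Z ⧸ m) ((Z ⧸ m) ⊗[Z] M) (h m hm)
  choose r hr using fun i ↦ m.exists_one_tmul_eq (b i)
  have hle : (⊤ : Submodule Z M) ≤ Submodule.span Z (Set.range r) ⊔ m • ⊤ := by
    intro x _
    choose c hc using fun i ↦ Ideal.Quotient.mk_surjective (b.repr (1 ⊗ₜ x) i)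
    refine Submodule.mem_sup.mpr ⟨∑ i, c i • r i, ?_, x - ∑ i, c i • r i, ?_, by abel⟩
    · exact sum_mem fun i _ ↦ Submodule.smul_mem _ _ (Submodule.subset_span ⟨i, rfl⟩)
    · rw [← Ideal.one_tmul_eq_zero_iff, TensorProduct.tmul_sub, TensorProduct.tmul_sum, sub_eq_zero]
      conv_lhs => rw [← b.sum_repr (1 ⊗ₜ x)]
      refine Finset.sum_congr rfl fun i _ ↦ ?_
      rw [← hc, ← hr, TensorProduct.tmul_smul, ← Ideal.Quotient.algebraMap_eq, algebraMap_smul]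
  obtain ⟨s, hsm, hs⟩ := Submodule.exists_sub_one_mem_and_smul_le_of_fg_of_le_sup
    (Module.Finite.fg_top (R := Z) (M := M)) le_rfl hle
  have hs' (x : M) : s • x ∈ Submodule.span Z (Set.range r) :=
    hs (Submodule.smul_mem_pointwise_smul x s ⊤ trivial)
  have hsm' : s ∉ m := fun hmem ↦
    hm.ne_top ((Ideal.eq_top_iff_one m).mpr (by simpa using m.sub_mem hmem hsm))
  refine ⟨s, hsm', r, Fintype.linearIndependent_iff.mpr fun c hc i ↦ ?_, hs'⟩
  have hs0 : s ≠ 0 := by rintro rfl; exact hsm' m.zero_mem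
  refine (mul_eq_zero.mp (Ideal.eq_zero_of_forall_isMaximal_mem fun p hp ↦ ?_ :
    s * c i = 0)).resolve_left hs0
  by_cases hsp : s ∈ p
  · exact p.mul_mem_right _ hsp
  refine p.mul_mem_left _ ?_
  let := Ideal.Quotient.field p
  have hspan : ⊤ ≤ Submodule.span (Z ⧸ p) (Set.range fun i ↦ (1 : Z ⧸ p) ⊗ₜ[Z] r i) := by
    intro y _
    obtain ⟨x, rfl⟩ := p.exists_one_tmul_eq y
    have hu : (Ideal.Quotient.mk p s) ≠ 0 := by rwa [Ne, Ideal.Quotient.eq_zero_iff_mem]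
    rw [← Submodule.smul_mem_iff _ hu, ← Ideal.Quotient.algebraMap_eq, algebraMap_smul,
      ← TensorProduct.tmul_smul]
    have := Submodule.mem_map_of_mem (f := TensorProduct.mk Z (Z ⧸ p) M 1) (hs' x)
    rw [Submodule.map_span, ← Set.range_comp] at this
    exact Submodule.span_subset_span Z (Z ⧸ p) _ this
  have hli := linearIndependent_of_top_le_span_of_card_eq_finrank hspan (by simp [h p hp])
  have := Fintype.linearIndependent_iff.mp hli (fun i ↦ Ideal.Quotient.mk p (c i)) (by
    have := congrArg (TensorProduct.mk Z (Z ⧸ p) M 1) hc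
    simpa [← Ideal.Quotient.algebraMap_eq] using this) i
  rwa [Ideal.Quotient.eq_zero_iff_mem] at this

/-- A finite module over a Jacobson domain whose closed fibres all have the same dimension is
projective. -/
theorem Module.Projective.of_finrank_fibre_eq [IsDomain Z] [IsJacobsonRing Z]
    [Module.Finite Z M] {n : ℕ}
    (h : ∀ m : Ideal Z, m.IsMaximal → Module.finrank (Z ⧸ m) ((Z ⧸ m) ⊗[Z] M) = n) :
    Module.Projective Z M := by
  refine Module.Projective.of_one_mem_range_dualTensorHom ?_
  let I : Ideal Z :=
    (dualTensorHom Z M M).range.comap (LinearMap.toSpanSingleton Z (M →ₗ[Z] M) 1)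
  suffices hI : I = ⊤ by
    simpa [I] using (Ideal.eq_top_iff_one I).mp hI
  by_contra hI
  obtain ⟨m, hm, hIm⟩ := Ideal.exists_le_maximal I hI
  obtain ⟨s, hsm, r, hr, hs⟩ := Module.exists_linearIndependent_smul_mem_span h m hm
  refine hsm (hIm ?_)
  let e : M →ₗ[Z] Fin n →₀ Z := hr.repr ∘ₗ
    (LinearMap.lsmul Z M s).codRestrict (Submodule.span Z (Set.range r)) hs
  refine ⟨∑ i, (Finsupp.lapply i ∘ₗ e) ⊗ₜ r i, ?_⟩
  ext x
  have := hr.linearCombination_repr ⟨s • x, hs x⟩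
  rw [Finsupp.linearCombination_apply, Finsupp.sum_fintype _ _ (by simp)] at this
  simpa [e, dualTensorHom_apply] using! this

end Fibres

section BaseChange

variable (Z F A : Type*) [CommRing Z] [CommRing F] [Algebra Z F] [Ring A] [Algebra Z A]

/-- Base change of the enveloping algebra `A ⊗ Aᵐᵒᵖ`, as a linear equivalence. -/
noncomputable def envelopingBaseChange :
    F ⊗[Z] (A ⊗[Z] Aᵐᵒᵖ) ≃ₗ[F] (F ⊗[Z] A) ⊗[F] (F ⊗[Z] A)ᵐᵒᵖ :=
  (LinearEquiv.baseChange Z F _ _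
    (TensorProduct.congr (.refl Z A) (MulOpposite.opLinearEquiv Z).symm)).trans <|
  (TensorProduct.AlgebraTensorModule.distribBaseChange Z F A A).trans <|
    TensorProduct.congr (.refl F _) (MulOpposite.opLinearEquiv F)

@[simp]
theorem envelopingBaseChange_one_tmul_tmul (a : A) (b : Aᵐᵒᵖ) :
    envelopingBaseChange Z F A (1 ⊗ₜ (a ⊗ₜ b)) =
      (1 ⊗ₜ a) ⊗ₜ MulOpposite.op (1 ⊗ₜ b.unop) := by
  simp [envelopingBaseChange]

theorem AlgHom.mulLeftRight_envelopingBaseChange (t : A ⊗[Z] Aᵐᵒᵖ) :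
    AlgHom.mulLeftRight F (F ⊗[Z] A) (envelopingBaseChange Z F A (1 ⊗ₜ t)) =
      (AlgHom.mulLeftRight Z A t).baseChange F := by
  induction t with
  | zero => simp
  | add x y hx hy => simp [TensorProduct.tmul_add, hx, hy, LinearMap.baseChange_add]
  | tmul a b => ext x; simp

end BaseChange

section Azumaya

variable {Z A : Type*} [CommRing Z] [Ring A] [Algebra Z A]

theorem AlgHom.mulLeftRight_injective_of_fibres [IsReduced Z] [IsJacobsonRing Z]
    [Module.Projective Z A]
    (h : ∀ m : Ideal Z, m.IsMaximal →
      Function.Injective (AlgHom.mulLeftRight (Z ⧸ m) ((Z ⧸ m) ⊗[Z] A))) :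
    Function.Injective (AlgHom.mulLeftRight Z A) := by
  have : Module.Projective Z Aᵐᵒᵖ := .of_equiv (MulOpposite.opLinearEquiv Z)
  refine (injective_iff_map_eq_zero _).mpr fun t ht ↦
    Module.Projective.eq_zero_of_forall_one_tmul_eq_zero (Z := Z) fun m hm ↦ ?_
  rw [← (envelopingBaseChange Z (Z ⧸ m) A).map_eq_zero_iff]
  refine (injective_iff_map_eq_zero _).mp (h m hm) _ ?_
  rw [AlgHom.mulLeftRight_envelopingBaseChange, ht, LinearMap.baseChange_zero]

theorem LinearMap.mem_smul_top_of_forall_mem {M N : Type*} [AddCommGroup M] [Module Z M]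
    [AddCommGroup N] [Module Z N] [Module.Finite Z M] [Module.Projective Z M] (m : Ideal Z)
    (φ : M →ₗ[Z] N) (h : ∀ x, φ x ∈ m • (⊤ : Submodule Z N)) :
    φ ∈ m • (⊤ : Submodule Z (M →ₗ[Z] N)) := by
  obtain ⟨t, ht⟩ := (dualTensorHom_bijective (R := Z) (M := M) (N := M)).2 LinearMap.id
  have hφ : φ = dualTensorHom Z M N (φ.lTensor _ t) := by
    rw [← LinearMap.comp_apply (dualTensorHom Z M N), dualTensorHom_comp_lTensor]
    simp [ht]
  rw [hφ]
  clear ht hφ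
  induction t with
  | zero => simp
  | add x y hx hy => simpa using add_mem hx hy
  | tmul f x =>
    have := Submodule.mem_map_of_mem
      (f := (dualTensorHom Z M N) ∘ₗ TensorProduct.mk Z (Module.Dual Z M) N f) (h x)
    rw [Submodule.map_smul''] at this
    simpa using Submodule.smul_mono le_rfl le_top this

theorem AlgHom.mulLeftRight_surjective_of_fibres [IsNoetherianRing Z]
    [Module.Finite Z A] [Module.Projective Z A]
    (h : ∀ m : Ideal Z, m.IsMaximal →
      Function.Surjective (AlgHom.mulLeftRight (Z ⧸ m) ((Z ⧸ m) ⊗[Z] A))) :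
    Function.Surjective (AlgHom.mulLeftRight Z A) := by
  let N : Submodule Z (Module.End Z A) := LinearMap.range (AlgHom.mulLeftRight Z A).toLinearMap
  suffices hN : ∀ φ, N.colon {φ} = ⊤ by
    intro φ
    have := (Ideal.eq_top_iff_one _).mp (hN φ)
    simpa [Submodule.mem_colon_singleton, N] using this
  intro φ
  by_contra hne
  obtain ⟨m, hm, hle⟩ := Ideal.exists_le_maximal _ hne
  have htop : (⊤ : Submodule Z (Module.End Z A)) ≤ N ⊔ m • ⊤ := by
    intro ψ _
    obtain ⟨τ, hτ⟩ := h m hm (ψ.baseChange (Z ⧸ m))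
    obtain ⟨y, rfl⟩ := (envelopingBaseChange Z (Z ⧸ m) A).surjective τ
    obtain ⟨t, rfl⟩ := m.exists_one_tmul_eq y
    refine Submodule.mem_sup.mpr ⟨AlgHom.mulLeftRight Z A t, ⟨t, rfl⟩,
      ψ - AlgHom.mulLeftRight Z A t, ?_, by abel⟩
    refine LinearMap.mem_smul_top_of_forall_mem m _ fun x ↦ ?_
    rw [AlgHom.mulLeftRight_envelopingBaseChange] at hτ
    rw [← Ideal.one_tmul_eq_zero_iff, LinearMap.sub_apply, TensorProduct.tmul_sub, sub_eq_zero]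
    simpa using (LinearMap.congr_fun hτ (1 ⊗ₜ x)).symm
  obtain ⟨s, hsm, hs⟩ := Submodule.exists_sub_one_mem_and_smul_le_of_fg_of_le_sup
    (Module.Finite.fg_top (R := Z) (M := Module.End Z A)) le_rfl htop
  have hsN : s • φ ∈ N := hs (Submodule.smul_mem_pointwise_smul φ s ⊤ trivial)
  have hmem : s ∈ m := hle (Submodule.mem_colon_singleton.mpr hsN)
  exact hm.ne_top ((Ideal.eq_top_iff_one m).mpr (by simpa using m.sub_mem hmem hsm))

theorem AlgHom.mulLeftRight_baseChange_surjective [Module.Projective Z A]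
    (h : Function.Surjective (AlgHom.mulLeftRight Z A)) (m : Ideal Z) :
    Function.Surjective (AlgHom.mulLeftRight (Z ⧸ m) ((Z ⧸ m) ⊗[Z] A)) := by
  intro ψ
  let π : A →ₗ[Z] (Z ⧸ m) ⊗[Z] A := TensorProduct.mk Z (Z ⧸ m) A 1
  obtain ⟨φ, hφ⟩ := Module.projective_lifting_property π
    ((ψ.restrictScalars Z) ∘ₗ π) m.exists_one_tmul_eq
  obtain ⟨t, rfl⟩ := h φ
  refine ⟨envelopingBaseChange Z (Z ⧸ m) A (1 ⊗ₜ t), ?_⟩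
  rw [AlgHom.mulLeftRight_envelopingBaseChange]
  ext x
  simpa [π] using LinearMap.congr_fun hφ x

/-- A nonzero algebra over a field is simple if all its linear endomorphisms are sums of
maps `x ↦ a * x * b`. -/
theorem IsSimpleRing.of_mulLeftRight_surjective {F B : Type*} [Field F] [Ring B] [Algebra F B]
    [Nontrivial B] (h : Function.Surjective (AlgHom.mulLeftRight F B)) : IsSimpleRing B := by
  refine isSimpleRing_iff_isTwoSided_imp.mpr ⟨inferInstance, fun I _ ↦ or_iff_not_imp_left.mpr
    fun hI ↦ ?_⟩
  obtain ⟨x, hx, hx0⟩ := Submodule.exists_mem_ne_zero_of_ne_bot hI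
  obtain ⟨φ, hφ⟩ := Module.Projective.exists_dual_ne_zero F hx0
  obtain ⟨t, ht⟩ := h (φ.smulRight ((φ x)⁻¹ • (1 : B)))
  have key : ∀ t : B ⊗[F] Bᵐᵒᵖ, AlgHom.mulLeftRight F B t x ∈ I := fun t ↦ by
    induction t with
    | zero => simp
    | add y z hy hz => simpa using I.add_mem hy hz
    | tmul a b => simpa using I.mul_mem_right _ (I.mul_mem_left a hx)
  rw [Ideal.eq_top_iff_one]
  simpa [ht, hφ] using key t

end Azumaya

section Matrix

theorem Algebra.IsCentral.finrank_center (F B : Type*) [Field F] [Ring B] [Nontrivial B]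
    [Algebra F B] [Algebra.IsCentral F B] :
    Module.finrank (Subring.center B) B = Module.finrank F B := by
  have hmem (x : F) : algebraMap F B x ∈ Subring.center B :=
    Subring.mem_center_iff.mpr fun g ↦ (Algebra.commutes x g).symm
  refine (Algebra.finrank_eq_of_equiv_equiv (RingEquiv.ofBijective
    ((algebraMap F B).codRestrict (Subring.center B) hmem) ⟨RingHom.injective _, fun z ↦ ?_⟩)
    (RingEquiv.refl B) rfl).symm
  have hz : (z : B) ∈ Subalgebra.center F B := z.2
  rw [Algebra.IsCentral.center_eq_bot] at hz
  obtain ⟨x, hx⟩ := hz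
  exact ⟨x, Subtype.ext hx⟩

theorem RingEquiv.finrank_center_eq {B C : Type*} [Ring B] [Ring C] (e : B ≃+* C) :
    Module.finrank (Subring.center B) B = Module.finrank (Subring.center C) C :=
  Algebra.finrank_eq_of_equiv_equiv (Subring.centerCongr e) e (by ext; rfl)

theorem isAzumaya_of_ringEquiv_matrix {F K B : Type*} [Field F] [IsAlgClosed F] [Field K]
    [Ring B] [Algebra F B] [FiniteDimensional F B] {d : ℕ} (hd : 0 < d)
    (e : B ≃+* Matrix (Fin d) (Fin d) K) :
    IsAzumaya F B ∧ Module.finrank F B = d ^ 2 := by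
  have : NeZero d := ⟨hd.ne'⟩
  have : IsSimpleRing B := .of_ringEquiv e.symm inferInstance
  obtain ⟨n, _, ⟨e'⟩⟩ := IsSimpleRing.exists_algEquiv_matrix_of_isAlgClosed F B
  have := IsAzumaya.matrix F (Fin n)
  have hB : IsAzumaya F B := .of_AlgEquiv F _ _ e'.symm
  refine ⟨hB, ?_⟩
  rw [← Algebra.IsCentral.finrank_center F B, e.finrank_center_eq,
    Algebra.IsCentral.finrank_center K]
  simp [Module.finrank_matrix, sq]

end Matrix

section Centre

variable (R : Type*) [Ring R]

theorem azumayaMulMap_eq_mulLeftRight :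
    azumayaMulMap R = (AlgHom.mulLeftRight (Subring.center R) R).toLinearMap := by
  refine TensorProduct.ext' fun a b ↦ LinearMap.ext fun x ↦ ?_
  simp [azumayaMulMap]

theorem TwoSidedIdeal.mem_span_center_iff (m : Ideal (Subring.center R)) (x : R) :
    x ∈ TwoSidedIdeal.span ((fun z : Subring.center R => (z : R)) '' (m : Set _)) ↔
      x ∈ m • (⊤ : Submodule (Subring.center R) R) := by
  constructor
  · intro hx
    rw [← Ideal.one_tmul_eq_zero_iff]
    let π : R →ₐ[Subring.center R] (Subring.center R ⧸ m) ⊗[Subring.center R] R :=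
      Algebra.TensorProduct.includeRight
    suffices h : TwoSidedIdeal.span ((fun z : Subring.center R => (z : R)) '' (m : Set _)) ≤
        TwoSidedIdeal.ker π from (TwoSidedIdeal.mem_ker π).mp (h hx)
    rw [TwoSidedIdeal.span_le]
    rintro _ ⟨z, hz, rfl⟩
    refine (TwoSidedIdeal.mem_ker π).mpr ((π.commutes z).trans ?_)
    rw [IsScalarTower.algebraMap_apply _ (Subring.center R ⧸ m), Ideal.Quotient.algebraMap_eq,
      Ideal.Quotient.eq_zero_iff_mem.mpr hz, map_zero]
  · intro hx
    induction hx using Submodule.smul_induction_on' with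
    | smul z hz r _ =>
      exact TwoSidedIdeal.mul_mem_right _ _ _ (TwoSidedIdeal.subset_span ⟨z, hz, rfl⟩)
    | add x _ y _ hx hy => exact TwoSidedIdeal.add_mem _ hx hy

/-- The ring `R / mR` is the fibre of `R` at the ideal `m` of its centre. -/
noncomputable def quotientSpanCenterEquiv (m : Ideal (Subring.center R)) :
    (TwoSidedIdeal.span
      ((fun z : Subring.center R => (z : R)) '' (m : Set (Subring.center R)))).ringCon.Quotient ≃+*
      (Subring.center R ⧸ m) ⊗[Subring.center R] R :=
  (RingCon.congr (.refl R) (by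
    ext x y
    rw [TwoSidedIdeal.rel_iff, TwoSidedIdeal.mem_span_center_iff, ← Ideal.one_tmul_eq_zero_iff,
      TensorProduct.tmul_sub, sub_eq_zero]
    rfl)).trans <|
  RingCon.quotientKerEquivOfSurjective
    (Algebra.TensorProduct.includeRight :
      R →ₐ[Subring.center R] (Subring.center R ⧸ m) ⊗[Subring.center R] R).toRingHom
    m.exists_one_tmul_eq

variable {R}

theorem IsPrimeRing.isDomain_center [Nontrivial R] (hR : IsPrimeRing R) :
    IsDomain (Subring.center R) := by
  have : NoZeroDivisors (Subring.center R) := ⟨fun {a b} hab ↦ by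
    have hab' : (a : R) * b = 0 := congrArg Subtype.val hab
    refine (hR a b fun x ↦ ?_).imp Subtype.ext Subtype.ext
    rw [← Subring.mem_center_iff.mp a.2 x, mul_assoc, hab', mul_zero]⟩
  exact NoZeroDivisors.to_isDomain _

/-- **Artin–Tate**: the centre of an affine algebra which is finite over its centre is affine. -/
theorem Algebra.FiniteType.of_module_finite_tower (k Z R : Type*) [CommRing k] [IsNoetherianRing k]
    [CommRing Z] [Ring R] [Algebra k Z] [Algebra Z R] [Algebra k R] [IsScalarTower k Z R]
    [FaithfulSMul Z R] [Module.Finite Z R] [Algebra.FiniteType k R] : Algebra.FiniteType k Z := by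
  obtain ⟨B, hkB, hBR⟩ := exists_subalgebra_of_fg k Z R Algebra.FiniteType.out
    (Module.Finite.fg_top (R := Z) (M := R))
  have : IsNoetherianRing B := isNoetherianRing_of_fg hkB
  have : Module.Finite B R := ⟨hBR⟩
  have : Module.Finite B Z := Module.Finite.of_injective
    (IsScalarTower.toAlgHom B Z R).toLinearMap (FaithfulSMul.algebraMap_injective Z R)
  have : Algebra.FiniteType k B := ⟨B.fg_top.mpr hkB⟩
  exact Algebra.FiniteType.trans (S := B) inferInstance inferInstance

/-- **Nullstellensatz**: residue fields of affine algebras over an algebraically closed field. -/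
theorem Ideal.nonempty_ringEquiv_quotient_of_isAlgClosed (k : Type*) {Z : Type*} [Field k]
    [IsAlgClosed k] [CommRing Z] [Algebra k Z] [Algebra.FiniteType k Z] (m : Ideal Z)
    (hm : m.IsMaximal) : Nonempty (k ≃+* Z ⧸ m) := by
  let := Ideal.Quotient.field m
  have := finite_of_finite_type_of_isJacobsonRing k (Z ⧸ m)
  exact ⟨RingEquiv.ofBijective (algebraMap k (Z ⧸ m))
    IsAlgClosed.algebraMap_bijective_of_isIntegral⟩

/-- The closed fibre of an algebra with surjective `AlgHom.mulLeftRight` is a matrix algebra. -/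
theorem nonempty_fibre_ringEquiv_matrix.{u, v} {k Z : Type u} {A : Type v} [Field k]
    [IsAlgClosed k] [CommRing Z] [Ring A] [Algebra Z A] [Module.Finite Z A] [Module.Projective Z A]
    (h : Function.Surjective (AlgHom.mulLeftRight Z A)) {m : Ideal Z} (hm : m.IsMaximal)
    (ek : k ≃+* Z ⧸ m) {d : ℕ} (hd : 0 < d)
    (hrank : Module.finrank (Z ⧸ m) ((Z ⧸ m) ⊗[Z] A) = d ^ 2) :
    Nonempty ((Z ⧸ m) ⊗[Z] A ≃+* Matrix (Fin d) (Fin d) k) := by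
  let := Ideal.Quotient.field m
  have : IsAlgClosed (Z ⧸ m) := .of_ringEquiv k _ ek
  have : Nontrivial ((Z ⧸ m) ⊗[Z] A) :=
    Module.nontrivial_of_finrank_pos (R := Z ⧸ m) (hrank ▸ by positivity)
  have := IsSimpleRing.of_mulLeftRight_surjective (F := Z ⧸ m)
    (AlgHom.mulLeftRight_baseChange_surjective h m)
  obtain ⟨n, _, ⟨e⟩⟩ :=
    IsSimpleRing.exists_algEquiv_matrix_of_isAlgClosed (Z ⧸ m) ((Z ⧸ m) ⊗[Z] A)
  have hn : n ^ 2 = d ^ 2 := by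
    rw [← hrank, e.toLinearEquiv.finrank_eq]
    simp [Module.finrank_matrix, sq]
  obtain rfl : n = d := Nat.pow_left_injective two_ne_zero hn
  exact ⟨e.toRingEquiv.trans ek.symm.mapMatrix⟩

end Centre

/-- A prime affine `k`-algebra `R`, finite over its centre `Z` and of PI degree `d`, is
Azumaya of rank `d²` iff `R/mR ≅ M_d(k)` for every maximal ideal `m` of `Z`. -/
theorem azumaya_iff_matrix_fibres
    (k : Type) [Field k] [IsAlgClosed k] [CharZero k]
    (R : Type) [Ring R] [Algebra k R] (hfg : Algebra.FiniteType k R)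
    (hR : IsPrimeRing R)
    (hfin : Module.Finite (Subring.center R) R)
    (d : ℕ) (hd : 0 < d)
    (Q : Type) [Ring Q] (f : R →+* Q) (hQ : IsGoldieQuotientRing f)
    [IsSimpleRing Q]
    (hPIdeg : Module.finrank (Subring.center Q) Q = d ^ 2) :
    (IsAzumayaAlgebra R ∧ HasAzumayaRank R (d ^ 2)) ↔
      ∀ m : Ideal (Subring.center R), m.IsMaximal →
        Nonempty
          ((TwoSidedIdeal.span
              ((fun z : Subring.center R => (z : R)) ''
                (m : Set (Subring.center R)))).ringCon.Quotient ≃+*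
            Matrix (Fin d) (Fin d) k) := by

  have : Nontrivial R := f.domain_nontrivial
  have := hR.isDomain_center
  let : Algebra k (Subring.center R) :=
    ((algebraMap k R).codRestrict (Subring.center R) fun x ↦
      Subring.mem_center_iff.mpr fun g ↦ (Algebra.commutes x g).symm).toAlgebra
  have : IsScalarTower k (Subring.center R) R := .of_algebraMap_eq fun _ ↦ rfl
  have : FaithfulSMul (Subring.center R) R :=
    (faithfulSMul_iff_algebraMap_injective _ _).mpr Subtype.val_injective
  have : Algebra.FiniteType k (Subring.center R) := .of_module_finite_tower k _ R
  have : IsNoetherianRing (Subring.center R) := Algebra.FiniteType.isNoetherianRing k _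
  have : IsJacobsonRing (Subring.center R) := isJacobsonRing_of_finiteType (A := k)
  rw [IsAzumayaAlgebra, HasAzumayaRank, azumayaMulMap_eq_mulLeftRight]
  constructor
  · rintro ⟨⟨_, _, hbij⟩, hrank⟩ m hm
    obtain ⟨ek⟩ := m.nonempty_ringEquiv_quotient_of_isAlgClosed k hm
    obtain ⟨e⟩ := nonempty_fibre_ringEquiv_matrix hbij.2 hm ek hd
      (m.finrank_quotient_tensor.trans (hrank m hm))
    exact ⟨(quotientSpanCenterEquiv R m).trans e⟩
  · intro h
    have key (m : Ideal (Subring.center R)) (hm : m.IsMaximal) :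
        Function.Bijective (AlgHom.mulLeftRight (Subring.center R ⧸ m)
          ((Subring.center R ⧸ m) ⊗[Subring.center R] R)) ∧
        Module.finrank (Subring.center R ⧸ m)
          ((Subring.center R ⧸ m) ⊗[Subring.center R] R) = d ^ 2 := by
      let := Ideal.Quotient.field m
      obtain ⟨ek⟩ := m.nonempty_ringEquiv_quotient_of_isAlgClosed k hm
      have : IsAlgClosed (Subring.center R ⧸ m) := .of_ringEquiv k _ ek
      obtain ⟨e⟩ := h m hm
      obtain ⟨hA, hrank⟩ := isAzumaya_of_ringEquiv_matrix (F := Subring.center R ⧸ m) hd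
        ((quotientSpanCenterEquiv R m).symm.trans e)
      exact ⟨hA.bij, hrank⟩
    have hproj : Module.Projective (Subring.center R) R :=
      .of_finrank_fibre_eq fun m hm ↦ (key m hm).2
    exact ⟨⟨hfin, hproj, AlgHom.mulLeftRight_injective_of_fibres fun m hm ↦ (key m hm).1.1,
      AlgHom.mulLeftRight_surjective_of_fibres fun m hm ↦ (key m hm).1.2⟩,
      fun m hm ↦ m.finrank_quotient_tensor.symm.trans (key m hm).2⟩
end

section
/- Let R be a prime noetherian ring with Goldie quotient ring Q = Q(R). For a nonzero (two-sided) ideal I of R set O_ℓ(I) = {q ∈ Q : qI ⊆ I} and O_r(I) = {q ∈ Q : Iq ⊆ I}. Then the following are equivalent: (1) R is a maximal order; (2) O_ℓ(I) = R = O_r(I) for every nonzero ideal I of R; (3) O_ℓ(p) = R = O_r(p) for every nonzero prime ideal p of R. -/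
/-- A ring is *two-sided noetherian* if it is both left and right noetherian. -/
def IsTwoSidedNoetherianRing (R : Type*) [Ring R] : Prop :=
  IsNoetherianRing R ∧ IsNoetherianRing Rᵐᵒᵖ

/-- `R` (viewed inside its quotient ring `Q` via `f`) is a *maximal order*: there is no
ring `R ⊊ R' ⊆ Q` with `a R' b ⊆ R` for some nonzero `a, b ∈ R`. -/
def IsMaximalOrder {R Q : Type*} [Ring R] [Ring Q] (f : R →+* Q) : Prop :=
  ¬ ∃ R' : Subring Q, f.range < R' ∧ ∃ a b : R, a ≠ 0 ∧ b ≠ 0 ∧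
      ∀ x ∈ R', f a * x * f b ∈ f.range

/-- A two-sided ideal `P` of a ring `R` is *prime* if it is proper and
`a R b ⊆ P` implies `a ∈ P` or `b ∈ P`. -/
def IsPrimeTwoSidedIdeal {R : Type*} [Ring R] (P : TwoSidedIdeal R) : Prop :=
  (P : Set R) ≠ Set.univ ∧ ∀ a b : R, (∀ x : R, a * x * b ∈ P) → a ∈ P ∨ b ∈ P

/-- In a left noetherian ring, two-sided ideals satisfy the ascending chain condition. -/
theorem TwoSidedIdeal.wellFounded_gt_of_isNoetherianRing {R : Type*} [Ring R]
    [IsNoetherianRing R] : WellFounded ((· > ·) : TwoSidedIdeal R → TwoSidedIdeal R → Prop) := by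
  have h : WellFounded ((· > ·) : Ideal R → Ideal R → Prop) := wellFounded_gt
  refine Subrelation.wf ?_ (InvImage.wf (fun I : TwoSidedIdeal R => I.asIdeal) h)
  intro I J hIJ
  refine lt_of_le_of_ne (TwoSidedIdeal.asIdeal.monotone hIJ.le) fun he => hIJ.ne ?_
  ext x
  rw [← TwoSidedIdeal.mem_asIdeal, ← TwoSidedIdeal.mem_asIdeal]
  exact SetLike.ext_iff.1 he x

/-- A predicate on nonzero two-sided ideals of a left noetherian ring holds everywhere as soon as
it holds at each nonzero ideal for which it holds at all strictly larger ideals. -/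
theorem TwoSidedIdeal.noetherian_induction {R : Type*} [Ring R] [IsNoetherianRing R]
    {p : TwoSidedIdeal R → Prop}
    (h : ∀ I : TwoSidedIdeal R, (∃ x ∈ I, x ≠ 0) → (∀ J, I < J → p J) → p I)
    (I : TwoSidedIdeal R) (hI : ∃ x ∈ I, x ≠ 0) : p I := by
  revert hI
  refine TwoSidedIdeal.wellFounded_gt_of_isNoetherianRing.induction
    (C := fun I : TwoSidedIdeal R => (∃ x ∈ I, x ≠ 0) → p I) I ?_
  rintro I ih ⟨x, hx, hx0⟩
  exact h I ⟨x, hx, hx0⟩ fun J hJ => ih J hJ ⟨x, hJ.le hx, hx0⟩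

section Multipliers

variable {R Q : Type*} [Ring R] [Ring Q] (f : R →+* Q)

/-- The left order `O_ℓ(I)` of an ideal `I` of `R`, taken in the overring `Q`. -/
def leftOrder (I : TwoSidedIdeal R) : Subring Q where
  carrier := {q | ∀ a ∈ I, q * f a ∈ f '' (I : Set R)}
  mul_mem' := by
    intro p q hp hq a ha
    obtain ⟨b, hb, hb'⟩ := hq a ha
    rw [mul_assoc, ← hb']
    exact hp b hb
  one_mem' := fun a ha => ⟨a, ha, by simp⟩
  add_mem' := by
    intro p q hp hq a ha
    obtain ⟨b, hb, hb'⟩ := hp a ha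
    obtain ⟨c, hc, hc'⟩ := hq a ha
    exact ⟨b + c, I.add_mem hb hc, by rw [map_add, hb', hc', add_mul]⟩
  zero_mem' := fun a _ => ⟨0, I.zero_mem, by simp⟩
  neg_mem' := by
    intro p hp a ha
    obtain ⟨b, hb, hb'⟩ := hp a ha
    exact ⟨-b, I.neg_mem hb, by rw [map_neg, hb', neg_mul]⟩

/-- The right order `O_r(I)` of an ideal `I` of `R`, taken in the overring `Q`. -/
def rightOrder (I : TwoSidedIdeal R) : Subring Q where
  carrier := {q | ∀ a ∈ I, f a * q ∈ f '' (I : Set R)}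
  mul_mem' := by
    intro p q hp hq a ha
    obtain ⟨b, hb, hb'⟩ := hp a ha
    rw [← mul_assoc, ← hb']
    exact hq b hb
  one_mem' := fun a ha => ⟨a, ha, by simp⟩
  add_mem' := by
    intro p q hp hq a ha
    obtain ⟨b, hb, hb'⟩ := hp a ha
    obtain ⟨c, hc, hc'⟩ := hq a ha
    exact ⟨b + c, I.add_mem hb hc, by rw [map_add, hb', hc', mul_add]⟩
  zero_mem' := fun a _ => ⟨0, I.zero_mem, by simp⟩
  neg_mem' := by
    intro p hp a ha
    obtain ⟨b, hb, hb'⟩ := hp a ha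
    exact ⟨-b, I.neg_mem hb, by rw [map_neg, hb', mul_neg]⟩

theorem range_le_leftOrder (I : TwoSidedIdeal R) : f.range ≤ leftOrder f I := by
  rintro _ ⟨r, rfl⟩ a ha
  exact ⟨r * a, I.mul_mem_left _ _ ha, map_mul _ _ _⟩

theorem range_le_rightOrder (I : TwoSidedIdeal R) : f.range ≤ rightOrder f I := by
  rintro _ ⟨r, rfl⟩ a ha
  exact ⟨a * r, I.mul_mem_right _ _ ha, map_mul _ _ _⟩

theorem setOf_left_eq_range_iff (I : TwoSidedIdeal R) :
    {q : Q | ∀ a ∈ I, q * f a ∈ f '' (I : Set R)} = Set.range f ↔ leftOrder f I ≤ f.range :=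
  ⟨fun h _ hq => h.subset hq, fun h => Set.Subset.antisymm h (range_le_leftOrder f I)⟩

theorem setOf_right_eq_range_iff (I : TwoSidedIdeal R) :
    {q : Q | ∀ a ∈ I, f a * q ∈ f '' (I : Set R)} = Set.range f ↔ rightOrder f I ≤ f.range :=
  ⟨fun h _ hq => h.subset hq, fun h => Set.Subset.antisymm h (range_le_rightOrder f I)⟩

variable {f}

theorem IsMaximalOrder.leftOrder_le_range (h : IsMaximalOrder f) {I : TwoSidedIdeal R}
    (hI : ∃ x ∈ I, x ≠ 0) : leftOrder f I ≤ f.range := by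
  obtain ⟨b, hb, hb0⟩ := hI
  by_contra hle
  refine h ⟨leftOrder f I, lt_of_le_not_ge (range_le_leftOrder f I) hle, b, b, hb0, hb0,
    fun x hx => ?_⟩
  obtain ⟨c, -, hc⟩ := hx b hb
  exact ⟨b * c, by rw [map_mul, hc, mul_assoc]⟩

theorem IsMaximalOrder.rightOrder_le_range (h : IsMaximalOrder f) {I : TwoSidedIdeal R}
    (hI : ∃ x ∈ I, x ≠ 0) : rightOrder f I ≤ f.range := by
  obtain ⟨b, hb, hb0⟩ := hI
  by_contra hle
  refine h ⟨rightOrder f I, lt_of_le_not_ge (range_le_rightOrder f I) hle, b, b, hb0, hb0,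
    fun x hx => ?_⟩
  obtain ⟨c, -, hc⟩ := hx b hb
  exact ⟨c * b, by rw [map_mul, hc]⟩

/-- If all left and right orders of nonzero ideals are trivial, then the ring is a maximal
order. -/
theorem isMaximalOrder_of_orders_le_range
    (hl : ∀ I : TwoSidedIdeal R, (∃ x ∈ I, x ≠ 0) → leftOrder f I ≤ f.range)
    (hr : ∀ I : TwoSidedIdeal R, (∃ x ∈ I, x ≠ 0) → rightOrder f I ≤ f.range) :
    IsMaximalOrder f := by
  rintro ⟨S, hS, a, b, ha0, hb0, hab⟩
  have hfS : ∀ r, f r ∈ S := fun r => hS.le ⟨r, rfl⟩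
  let I : TwoSidedIdeal R := TwoSidedIdeal.mk' {r | ∀ x ∈ S, f r * x * f b ∈ f.range}
    (fun x _ => by simp)
    (fun {r s} h₁ h₂ x hx => by
      rw [map_add, add_mul, add_mul]; exact add_mem (h₁ x hx) (h₂ x hx))
    (fun {r} h₁ x hx => by
      rw [map_neg, neg_mul, neg_mul]; exact neg_mem (h₁ x hx))
    (fun {s r} h₁ x hx => by
      rw [map_mul, mul_assoc, mul_assoc, ← mul_assoc (f r)]
      exact mul_mem ⟨s, rfl⟩ (h₁ x hx))
    (fun {r s} h₁ x hx => by
      rw [map_mul, mul_assoc (f r)]; exact h₁ _ (mul_mem (hfS s) hx))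
  have hI : ∀ r, r ∈ I ↔ ∀ x ∈ S, f r * x * f b ∈ f.range := fun r =>
    TwoSidedIdeal.mem_mk' ..
  have hSb : ∀ x ∈ S, x * f b ∈ f.range := by
    intro x hx
    refine hr I ⟨a, (hI a).2 hab, ha0⟩ fun r hrI => ?_
    obtain ⟨c, hc⟩ := (hI r).1 hrI x hx
    rw [← mul_assoc]
    refine ⟨c, (hI c).2 fun y hy => ?_, hc⟩
    have := (hI r).1 hrI (x * f b * y) (mul_mem (mul_mem hx (hfS b)) hy)
    rw [hc]
    simpa only [mul_assoc] using this
  let J : TwoSidedIdeal R := TwoSidedIdeal.mk' {r | ∀ x ∈ S, x * f r ∈ f.range}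
    (fun x _ => by simp)
    (fun {r s} h₁ h₂ x hx => by
      rw [map_add, mul_add]; exact add_mem (h₁ x hx) (h₂ x hx))
    (fun {r} h₁ x hx => by
      rw [map_neg, mul_neg]; exact neg_mem (h₁ x hx))
    (fun {s r} h₁ x hx => by
      rw [map_mul, ← mul_assoc]; exact h₁ _ (mul_mem hx (hfS s)))
    (fun {r s} h₁ x hx => by
      rw [map_mul, ← mul_assoc]; exact mul_mem (h₁ x hx) ⟨s, rfl⟩)
  have hJ : ∀ r, r ∈ J ↔ ∀ x ∈ S, x * f r ∈ f.range := fun r => TwoSidedIdeal.mem_mk' ..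
  refine hS.not_ge fun x hx => hl J ⟨b, (hJ b).2 hSb, hb0⟩ fun r hrJ => ?_
  obtain ⟨c, hc⟩ := (hJ r).1 hrJ x hx
  refine ⟨c, (hJ c).2 fun y hy => ?_, hc⟩
  rw [hc, ← mul_assoc]
  exact (hJ r).1 hrJ _ (mul_mem hy hx)

/-- The ideal quotient `{x | x B ⊆ I}` of two-sided ideals. -/
def TwoSidedIdeal.leftColon (I : TwoSidedIdeal R) (B : TwoSidedIdeal R) : TwoSidedIdeal R :=
  TwoSidedIdeal.mk' {x | ∀ y ∈ B, x * y ∈ I}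
    (fun y _ => by rw [zero_mul]; exact I.zero_mem)
    (fun {r s} h₁ h₂ y hy => by rw [add_mul]; exact I.add_mem (h₁ y hy) (h₂ y hy))
    (fun {r} h₁ y hy => by rw [neg_mul]; exact I.neg_mem (h₁ y hy))
    (fun {s r} h₁ y hy => by rw [mul_assoc]; exact I.mul_mem_left _ _ (h₁ y hy))
    (fun {r s} h₁ y hy => by rw [mul_assoc]; exact h₁ _ (B.mul_mem_left _ _ hy))

/-- The ideal quotient `{x | A x ⊆ I}` of two-sided ideals. -/
def TwoSidedIdeal.rightColon (I : TwoSidedIdeal R) (A : TwoSidedIdeal R) : TwoSidedIdeal R :=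
  TwoSidedIdeal.mk' {x | ∀ y ∈ A, y * x ∈ I}
    (fun y _ => by rw [mul_zero]; exact I.zero_mem)
    (fun {r s} h₁ h₂ y hy => by rw [mul_add]; exact I.add_mem (h₁ y hy) (h₂ y hy))
    (fun {r} h₁ y hy => by rw [mul_neg]; exact I.neg_mem (h₁ y hy))
    (fun {s r} h₁ y hy => by rw [← mul_assoc]; exact h₁ _ (A.mul_mem_right _ _ hy))
    (fun {r s} h₁ y hy => by rw [← mul_assoc]; exact I.mul_mem_right _ _ (h₁ y hy))

theorem TwoSidedIdeal.mem_leftColon {I B : TwoSidedIdeal R} {x : R} :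
    x ∈ I.leftColon B ↔ ∀ y ∈ B, x * y ∈ I :=
  TwoSidedIdeal.mem_mk' ..

theorem TwoSidedIdeal.mem_rightColon {I A : TwoSidedIdeal R} {x : R} :
    x ∈ I.rightColon A ↔ ∀ y ∈ A, y * x ∈ I :=
  TwoSidedIdeal.mem_mk' ..

theorem TwoSidedIdeal.mem_of_mul_mul_mem_of_mem_span {I : TwoSidedIdeal R} {a b : R}
    (h : ∀ x, a * x * b ∈ I) {y : R} (hy : y ∈ TwoSidedIdeal.span {b}) (x : R) :
    a * x * y ∈ I := by
  let K : TwoSidedIdeal R := TwoSidedIdeal.mk' {y | ∀ x, a * x * y ∈ I}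
    (fun x => by rw [mul_zero]; exact I.zero_mem)
    (fun {r s} h₁ h₂ x => by rw [mul_add]; exact I.add_mem (h₁ x) (h₂ x))
    (fun {r} h₁ x => by rw [mul_neg]; exact I.neg_mem (h₁ x))
    (fun {s r} h₁ x => by rw [← mul_assoc, mul_assoc a]; exact h₁ _)
    (fun {r s} h₁ x => by rw [← mul_assoc]; exact I.mul_mem_right _ _ (h₁ x))
  have hK : ∀ y, y ∈ K ↔ ∀ x, a * x * y ∈ I := fun y => TwoSidedIdeal.mem_mk' ..
  have hle : TwoSidedIdeal.span {b} ≤ K :=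
    TwoSidedIdeal.span_le.2 (Set.singleton_subset_iff.2 ((hK b).2 h))
  exact (hK y).1 (hle hy) x

/-- A proper ideal that is not prime lies strictly below a pair of ideals which are each
other's quotients with respect to it. -/
theorem TwoSidedIdeal.exists_colon_of_not_prime {I : TwoSidedIdeal R}
    (hI : (I : Set R) ≠ Set.univ) (hp : ¬ IsPrimeTwoSidedIdeal I) :
    ∃ A B : TwoSidedIdeal R, I < A ∧ I < B ∧ A = I.leftColon B ∧ B = I.rightColon A := by
  have : ∃ a b : R, (∀ x, a * x * b ∈ I) ∧ a ∉ I ∧ b ∉ I := by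
    by_contra! hcon
    exact hp ⟨hI, fun a b hab => or_iff_not_imp_left.2 (hcon a b hab)⟩
  obtain ⟨a, b, hab, ha, hb⟩ := this
  set A := I.leftColon (TwoSidedIdeal.span {b}) with hA
  have hIA : I ≤ A := fun x hx => mem_leftColon.2 fun y _ => I.mul_mem_right _ _ hx
  have hIB : I ≤ I.rightColon A := fun x hx => mem_rightColon.2 fun y _ => I.mul_mem_left _ _ hx
  have haA : a ∈ A := mem_leftColon.2 fun y hy => by
    simpa using mem_of_mul_mul_mem_of_mem_span hab hy 1
  have hbB : b ∈ I.rightColon A := mem_rightColon.2 fun y hy =>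
    mem_leftColon.1 hy b (TwoSidedIdeal.subset_span rfl)
  refine ⟨A, I.rightColon A, lt_of_le_not_ge hIA fun h => ha (h haA),
    lt_of_le_not_ge hIB fun h => hb (h hbB), le_antisymm ?_ ?_, rfl⟩
  · exact fun x hx => mem_leftColon.2 fun y hy => mem_rightColon.1 hy x hx
  · refine fun x hx => mem_leftColon.2 fun y hy => mem_leftColon.1 hx y ?_
    exact TwoSidedIdeal.span_le.2 (Set.singleton_subset_iff.2 hbB) hy

theorem leftOrder_le_range_of_prime [IsNoetherianRing R] (hf : Function.Injective f)
    (h : ∀ P : TwoSidedIdeal R, IsPrimeTwoSidedIdeal P → (∃ x ∈ P, x ≠ 0) →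
      leftOrder f P ≤ f.range)
    (I : TwoSidedIdeal R) (hI : ∃ x ∈ I, x ≠ 0) : leftOrder f I ≤ f.range := by
  refine TwoSidedIdeal.noetherian_induction (p := fun I => leftOrder f I ≤ f.range)
    (fun I hI ih => ?_) I hI
  intro q hq
  by_cases htop : (I : Set R) = Set.univ
  · obtain ⟨c, -, hc⟩ := hq 1 (htop.superset (Set.mem_univ 1))
    exact ⟨c, by rw [hc, map_one, mul_one]⟩
  by_cases hp : IsPrimeTwoSidedIdeal I
  · exact h I hp hI hq
  obtain ⟨A, B, hIA, hIB, hA, hB⟩ := TwoSidedIdeal.exists_colon_of_not_prime htop hp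
  have hAB : ∀ x ∈ A, ∀ y ∈ B, x * y ∈ I := fun x hx =>
    TwoSidedIdeal.mem_leftColon.1 (hA ▸ hx)
  have hqAB : ∀ x ∈ A, ∀ y ∈ B, q * f x * f y ∈ f '' (I : Set R) := fun x hx y hy => by
    rw [mul_assoc, ← map_mul]
    exact hq _ (hAB x hx y hy)
  refine ih A hIA fun x hx => ?_
  obtain ⟨c, hc⟩ := ih B hIB fun y hy => Set.image_mono hIB.le (hqAB x hx y hy)
  refine ⟨c, ?_, hc⟩
  rw [SetLike.mem_coe, hA, TwoSidedIdeal.mem_leftColon]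
  intro y hy
  have := hqAB x hx y hy
  rwa [← hc, ← map_mul, hf.mem_set_image] at this

theorem rightOrder_le_range_of_prime [IsNoetherianRing R] (hf : Function.Injective f)
    (h : ∀ P : TwoSidedIdeal R, IsPrimeTwoSidedIdeal P → (∃ x ∈ P, x ≠ 0) →
      rightOrder f P ≤ f.range)
    (I : TwoSidedIdeal R) (hI : ∃ x ∈ I, x ≠ 0) : rightOrder f I ≤ f.range := by
  refine TwoSidedIdeal.noetherian_induction (p := fun I => rightOrder f I ≤ f.range)
    (fun I hI ih => ?_) I hI
  intro q hq
  by_cases htop : (I : Set R) = Set.univ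
  · obtain ⟨c, -, hc⟩ := hq 1 (htop.superset (Set.mem_univ 1))
    exact ⟨c, by rw [hc, map_one, one_mul]⟩
  by_cases hp : IsPrimeTwoSidedIdeal I
  · exact h I hp hI hq
  obtain ⟨A, B, hIA, hIB, hA, hB⟩ := TwoSidedIdeal.exists_colon_of_not_prime htop hp
  have hAB : ∀ x ∈ A, ∀ y ∈ B, x * y ∈ I := fun x hx =>
    TwoSidedIdeal.mem_leftColon.1 (hA ▸ hx)
  have hABq : ∀ y ∈ B, ∀ x ∈ A, f x * (f y * q) ∈ f '' (I : Set R) := fun y hy x hx => by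
    rw [← mul_assoc, ← map_mul]
    exact hq _ (hAB x hx y hy)
  refine ih B hIB fun y hy => ?_
  obtain ⟨c, hc⟩ := ih A hIA fun x hx => Set.image_mono hIA.le (hABq y hy x hx)
  refine ⟨c, ?_, hc⟩
  rw [SetLike.mem_coe, hB, TwoSidedIdeal.mem_rightColon]
  intro x hx
  have := hABq y hy x hx
  rwa [← hc, ← map_mul, hf.mem_set_image] at this

end Multipliers

/-- For a prime noetherian ring `R` with Goldie quotient ring `Q`, being a maximal order is
equivalent to `O_ℓ(I) = R = O_r(I)` for all nonzero ideals `I`, and also to the same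
condition for all nonzero prime ideals. -/
theorem maximalOrder_tfae
    (R : Type*) [Ring R] (hR : IsPrimeRing R) (hnoeth : IsTwoSidedNoetherianRing R)
    (Q : Type*) [Ring Q] (f : R →+* Q) (hQ : IsGoldieQuotientRing f) :
    (IsMaximalOrder f ↔
      ∀ I : TwoSidedIdeal R, (∃ x ∈ I, x ≠ (0 : R)) →
        ({q : Q | ∀ a ∈ I, q * f a ∈ (⇑f) '' (I : Set R)} = Set.range f ∧
         {q : Q | ∀ a ∈ I, f a * q ∈ (⇑f) '' (I : Set R)} = Set.range f)) ∧
    ((∀ I : TwoSidedIdeal R, (∃ x ∈ I, x ≠ (0 : R)) →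
        ({q : Q | ∀ a ∈ I, q * f a ∈ (⇑f) '' (I : Set R)} = Set.range f ∧
         {q : Q | ∀ a ∈ I, f a * q ∈ (⇑f) '' (I : Set R)} = Set.range f)) ↔
      (∀ P : TwoSidedIdeal R, IsPrimeTwoSidedIdeal P → (∃ x ∈ P, x ≠ (0 : R)) →
        ({q : Q | ∀ a ∈ P, q * f a ∈ (⇑f) '' (P : Set R)} = Set.range f ∧
         {q : Q | ∀ a ∈ P, f a * q ∈ (⇑f) '' (P : Set R)} = Set.range f))) := by
  have := hnoeth.1
  simp only [setOf_left_eq_range_iff, setOf_right_eq_range_iff]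
  refine ⟨⟨fun h I hI => ⟨h.leftOrder_le_range hI, h.rightOrder_le_range hI⟩, fun h => ?_⟩,
    fun h P _ hP => h P hP, fun h I hI => ⟨?_, ?_⟩⟩
  · exact isMaximalOrder_of_orders_le_range (fun I hI => (h I hI).1) fun I hI => (h I hI).2
  · exact leftOrder_le_range_of_prime hQ.injective (fun P hP hP0 => (h P hP hP0).1) I hI
  · exact rightOrder_le_range_of_prime hQ.injective (fun P hP hP0 => (h P hP hP0).2) I hI
end

section
/- Let k be an algebraically closed field of characteristic zero and let A = k_J[u,v] = k⟨u,v⟩/⟨uv − vu − u²⟩ be the Jordan plane. Then the symmetric Martindale ring of quotients of A is Q_s(A) = A[u^{−1}], the localisation of A at the powers of the normal element u. -/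
/-- The relation defining the Jordan plane `K_J[u,v]`: `v u = u v + u²`. -/
inductive JordanRel (K : Type*) [CommRing K] :
    FreeAlgebra K (Fin 2) → FreeAlgebra K (Fin 2) → Prop
  | rel : JordanRel K (FreeAlgebra.ι K 1 * FreeAlgebra.ι K 0)
      (FreeAlgebra.ι K 0 * FreeAlgebra.ι K 1 + FreeAlgebra.ι K 0 * FreeAlgebra.ι K 0)

/-- The Jordan plane `K_J[u,v] = K⟨u,v⟩/(vu - uv - u²)`. -/
abbrev JordanPlane (K : Type*) [CommRing K] := RingQuot (JordanRel K)

/-- The generator `u` of the Jordan plane. -/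
noncomputable def jU (K : Type*) [CommRing K] : JordanPlane K :=
  RingQuot.mkAlgHom K (JordanRel K) (FreeAlgebra.ι K 0)

/-- The generator `v` of the Jordan plane. -/
noncomputable def jV (K : Type*) [CommRing K] : JordanPlane K :=
  RingQuot.mkAlgHom K (JordanRel K) (FreeAlgebra.ι K 1)

/-- `f : A →+* B` exhibits `B` as the (right) Ore localization of `A` at the
submonoid `S`. -/
structure IsOreLocalization {A B : Type*} [Ring A] [Ring B] (S : Submonoid A)
    (f : A →+* B) : Prop where
  isUnit : ∀ s ∈ S, IsUnit (f s)
  num_den : ∀ b : B, ∃ a : A, ∃ s ∈ S, b * f s = f a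
  ker : ∀ a : A, f a = 0 → ∃ s ∈ S, a * s = 0

open Polynomial

namespace JordanPlane

section Normal

variable {R : Type*} [Ring R] {s : R}

/-- The left annihilator of an element `s` with `R s ⊆ s R`, a two-sided ideal. -/
def annihilatorOfNormal (s : R) (hs : ∀ r, ∃ r', r * s = s * r') : TwoSidedIdeal R :=
  TwoSidedIdeal.mk' {x | x * s = 0}
    (zero_mul _)
    (fun {x y} (hx : x * s = 0) (hy : y * s = 0) => show (x + y) * s = 0 by
      rw [add_mul, hx, hy, add_zero])
    (fun {x} (hx : x * s = 0) => show -x * s = 0 by rw [neg_mul, hx, neg_zero])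
    (fun {x y} (hy : y * s = 0) => show x * y * s = 0 by rw [mul_assoc, hy, mul_zero])
    (fun {x y} (hx : x * s = 0) => show x * y * s = 0 by
      obtain ⟨b, hb⟩ := hs y
      rw [mul_assoc, hb, ← mul_assoc, hx, zero_mul])

theorem mem_annihilatorOfNormal {hs : ∀ r, ∃ r', r * s = s * r'} {x : R} :
    x ∈ annihilatorOfNormal s hs ↔ x * s = 0 :=
  TwoSidedIdeal.mem_mk' ..

/-- The two-sided ideal `s R` generated by an element `s` with `R s ⊆ s R`. -/
def spanOfNormal (s : R) (hs : ∀ r, ∃ r', r * s = s * r') : TwoSidedIdeal R :=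
  TwoSidedIdeal.mk' {x | ∃ y, x = s * y}
    ⟨0, (mul_zero _).symm⟩
    (by rintro _ _ ⟨x, rfl⟩ ⟨y, rfl⟩; exact ⟨x + y, (mul_add _ _ _).symm⟩)
    (by rintro _ ⟨x, rfl⟩; exact ⟨-x, (mul_neg _ _).symm⟩)
    (by
      rintro x _ ⟨y, rfl⟩
      obtain ⟨b, hb⟩ := hs x
      exact ⟨b * y, by rw [← mul_assoc, hb, mul_assoc]⟩)
    (by rintro _ y ⟨x, rfl⟩; exact ⟨x * y, mul_assoc _ _ _⟩)

theorem mem_spanOfNormal {hs : ∀ r, ∃ r', r * s = s * r'} {x : R} :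
    x ∈ spanOfNormal s hs ↔ ∃ y, x = s * y :=
  TwoSidedIdeal.mem_mk' ..

end Normal

variable {k : Type*} [Field k]

theorem jV_mul_jU : jV k * jU k = jU k * jV k + jU k * jU k := by
  simpa only [jU, jV, map_mul, map_add] using
    RingQuot.mkAlgHom_rel k (JordanRel.rel (K := k))

/-- The element of the Jordan plane with normal form `∑ pⱼ(u) vʲ`. -/
noncomputable def ofNormalForm (P : k[X][X]) : JordanPlane k :=
  P.eval₂ (aeval (jU k) : k[X] →ₐ[k] JordanPlane k).toRingHom (jV k)

theorem ofNormalForm_add (P R : k[X][X]) :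
    ofNormalForm (P + R) = ofNormalForm P + ofNormalForm R :=
  eval₂_add _ _

theorem ofNormalForm_monomial (j : ℕ) (p : k[X]) :
    ofNormalForm (monomial j p) = aeval (jU k) p * jV k ^ j :=
  eval₂_monomial _ _

theorem ofNormalForm_C (p : k[X]) : ofNormalForm (C p) = aeval (jU k) p :=
  eval₂_C _ _

theorem jU_mul_aeval (p : k[X]) : jU k * aeval (jU k) p = aeval (jU k) p * jU k := by
  have h : aeval (jU k) (X * p) = aeval (jU k) (p * X) := by rw [mul_comm]
  simpa using h

theorem jV_mul_aeval (p : k[X]) :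
    jV k * aeval (jU k) p = aeval (jU k) p * jV k + aeval (jU k) (X * (X * derivative p)) := by
  induction p using Polynomial.induction_on with
  | C a =>
    simp only [aeval_C, derivative_C, mul_zero, map_zero, add_zero]
    exact (Algebra.commutes a (jV k)).symm
  | add p q hp hq =>
    simp only [map_add, mul_add, add_mul, hp, hq]
    abel
  | monomial n a ih =>
    have e : C a * X ^ (n + 1) = (C a * X ^ n) * (X : k[X]) := by ring
    have e' : aeval (jU k) (X * (X * derivative (C a * X ^ n * X))) =
        aeval (jU k) (C a * X ^ n) * (jU k * jU k) +
        aeval (jU k) (X * (X * derivative (C a * X ^ n))) * jU k := by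
      have : X * (X * derivative (C a * X ^ n * X)) = (C a * X ^ n) * (X * X) +
        (X * (X * derivative (C a * X ^ n))) * (X : k[X]) := by
        rw [derivative_mul, derivative_X]; ring
      rw [this, map_add, map_mul _ (C a * X ^ n), map_mul _ X X,
        map_mul _ (X * (X * _)) X, aeval_X]
    rw [e, e', map_mul, aeval_X, ← mul_assoc, ih, add_mul, mul_assoc, jV_mul_jU, mul_add]
    simp only [mul_assoc]
    abel

theorem jV_pow_mul_jU (j : ℕ) :
    jV k ^ j * jU k = jU k * jV k ^ j + jU k * (j * jV k ^ (j - 1)) * jU k := by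
  induction j with
  | zero => simp
  | succ j ih =>
    have h : jV k * (j * jV k ^ (j - 1)) = j * jV k ^ j := by
      cases j with
      | zero => simp
      | succ j =>
        rw [← mul_assoc, ← Nat.cast_comm, mul_assoc, Nat.add_sub_cancel, ← pow_succ']
    calc jV k ^ (j + 1) * jU k = jV k * (jV k ^ j * jU k) := by rw [pow_succ', mul_assoc]
      _ = (jV k * jU k) * jV k ^ j + (jV k * jU k) * (j * jV k ^ (j - 1)) * jU k := by
        rw [ih]; simp only [mul_add, mul_assoc]
      _ = jU k * jV k ^ (j + 1) + jU k * (jV k * (j * jV k ^ (j - 1))) * jU k +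
          jU k * (jU k * jV k ^ j + jU k * (j * jV k ^ (j - 1)) * jU k) := by
        rw [jV_mul_jU, pow_succ']; simp only [mul_add, add_mul, mul_assoc]; abel
      _ = _ := by
        rw [h, ← ih, Nat.add_sub_cancel, Nat.cast_succ]
        simp only [add_mul, mul_add, one_mul, mul_assoc]; abel

/-- Commutation with `u` is, up to factors `u` on both sides, formal differentiation in `v`. -/
theorem ofNormalForm_mul_jU (P : k[X][X]) :
    ofNormalForm P * jU k =
      jU k * ofNormalForm P + jU k * ofNormalForm (derivative P) * jU k := by
  induction P using Polynomial.induction_on' with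
  | add P R hP hR =>
    rw [derivative_add, ofNormalForm_add, ofNormalForm_add, add_mul, hP, hR]
    simp only [mul_add, add_mul]
    abel
  | monomial j p =>
    rw [derivative_monomial, ofNormalForm_monomial, ofNormalForm_monomial, mul_assoc,
      jV_pow_mul_jU, map_mul, map_natCast, mul_add]
    simp only [← mul_assoc, jU_mul_aeval]

theorem ofNormalForm_surjective : Function.Surjective (ofNormalForm (k := k)) := by
  have hadd : ∀ a : JordanPlane k, (∀ j p, ∃ P, ofNormalForm P = a * ofNormalForm (monomial j p)) →
      ∀ R, ∃ P, ofNormalForm P = a * ofNormalForm R := by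
    intro a h R
    induction R using Polynomial.induction_on' with
    | add R S hR hS =>
      obtain ⟨P, hP⟩ := hR
      obtain ⟨P', hP'⟩ := hS
      exact ⟨P + P', by rw [ofNormalForm_add, ofNormalForm_add, mul_add, hP, hP']⟩
    | monomial j p => exact h j p
  have key : ∀ (w : FreeAlgebra k (Fin 2)) (R : k[X][X]),
      ∃ P, ofNormalForm P = RingQuot.mkAlgHom k (JordanRel k) w * ofNormalForm R := by
    intro w
    induction w using FreeAlgebra.induction with
    | grade0 r =>
      refine hadd _ fun j p => ⟨monomial j (C r * p), ?_⟩
      rw [ofNormalForm_monomial, ofNormalForm_monomial, map_mul, aeval_C, AlgHom.commutes,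
        mul_assoc]
    | grade1 i =>
      refine hadd _ fun j p => ?_
      fin_cases i
      · refine ⟨monomial j (X * p), ?_⟩
        rw [ofNormalForm_monomial, ofNormalForm_monomial, map_mul, aeval_X, mul_assoc]
        rfl
      · refine ⟨monomial (j + 1) p + monomial j (X * (X * derivative p)), ?_⟩
        have := jV_mul_aeval p
        rw [ofNormalForm_add, ofNormalForm_monomial, ofNormalForm_monomial,
          ofNormalForm_monomial, pow_succ', ← mul_assoc, ← add_mul, ← this, mul_assoc]
        rfl
    | mul a b ha hb =>
      intro R
      obtain ⟨P, hP⟩ := hb R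
      obtain ⟨P', hP'⟩ := ha P
      exact ⟨P', by rw [hP', hP, map_mul, mul_assoc]⟩
    | add a b ha hb =>
      intro R
      obtain ⟨P, hP⟩ := ha R
      obtain ⟨P', hP'⟩ := hb R
      exact ⟨P + P', by rw [ofNormalForm_add, hP', hP, map_add, add_mul]⟩
  intro a
  obtain ⟨w, rfl⟩ := RingQuot.mkAlgHom_surjective k (JordanRel k) a
  obtain ⟨P, hP⟩ := key w (C 1)
  exact ⟨P, by rw [hP, ofNormalForm_C, map_one, mul_one]⟩

theorem exists_mul_jU_pow (n : ℕ) (a : JordanPlane k) : ∃ b, a * jU k ^ n = jU k ^ n * b := by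
  induction n with
  | zero => exact ⟨a, by simp⟩
  | succ n ih =>
    obtain ⟨b, hb⟩ := ih
    obtain ⟨P, rfl⟩ := ofNormalForm_surjective b
    refine ⟨ofNormalForm P + ofNormalForm (derivative P) * jU k, ?_⟩
    rw [pow_succ, ← mul_assoc, hb, mul_assoc, ofNormalForm_mul_jU, mul_add]
    simp only [mul_add, mul_assoc]

theorem exists_jU_pow_mul (n : ℕ) (a : JordanPlane k) : ∃ b, jU k ^ n * a = b * jU k ^ n := by
  induction n with
  | zero => exact ⟨a, by simp⟩
  | succ n ih =>
    obtain ⟨b, hb⟩ := ih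
    obtain ⟨P, rfl⟩ := ofNormalForm_surjective b
    refine ⟨ofNormalForm P - jU k * ofNormalForm (derivative P), ?_⟩
    rw [pow_succ', mul_assoc, hb, ← mul_assoc, ← mul_assoc, sub_mul, ofNormalForm_mul_jU,
      add_sub_cancel_right]

/-- The Jordan plane acts on `k[x]` with `u` acting as `x` and `v` as `x² d/dx`. -/
noncomputable def toEnd (k : Type*) [Field k] : JordanPlane k →ₐ[k] Module.End k k[X] :=
  RingQuot.liftAlgHom k ⟨FreeAlgebra.lift k
    ![LinearMap.mulLeft k X, LinearMap.mulLeft k (X * X) ∘ₗ derivative], by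
      rintro _ _ ⟨⟩
      ext1 n
      ext1
      simp only [map_mul, map_add, FreeAlgebra.lift_ι_apply, Matrix.cons_val_zero,
        Matrix.cons_val_one, LinearMap.comp_apply, Module.End.mul_apply, LinearMap.add_apply,
        LinearMap.mulLeft_apply, derivative_mul, derivative_X]
      ring⟩

theorem toEnd_jU : toEnd k (jU k) = LinearMap.mulLeft k X := by
  simp [toEnd, jU]

theorem jU_pow_ne_zero (n : ℕ) : jU k ^ n ≠ 0 := by
  intro h
  have h1 := congrArg (fun a => toEnd k a 1) h
  simp only [map_pow, toEnd_jU, LinearMap.pow_mulLeft, LinearMap.mulLeft_apply, mul_one, map_zero,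
    LinearMap.zero_apply] at h1
  exact pow_ne_zero n X_ne_zero h1

section CharZero

variable [CharZero k]

theorem exists_jU_pow_mem_of_aeval_mem (I : TwoSidedIdeal (JordanPlane k)) (p : k[X])
    (hp : p ≠ 0) (h : aeval (jU k) p ∈ I) : ∃ n, jU k ^ n ∈ I := by
  induction hN : p.support.card using Nat.strong_induction_on generalizing p with
  | _ N ih =>
    obtain ⟨i, hi⟩ := nonempty_support_iff.mpr hp
    have hcoeff : ∀ j, (X * derivative p - C (i : k) * p).coeff j = (j - i) * p.coeff j := by
      intro j
      rw [coeff_sub, coeff_C_mul]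
      cases j with
      | zero => simp
      | succ j => rw [coeff_X_mul, coeff_derivative]; push_cast; ring
    have hmem : aeval (jU k) (X * (X * derivative p - C (i : k) * p)) ∈ I := by
      have h1 := I.sub_mem (I.mul_mem_left (jV k) _ h) (I.mul_mem_right _ (jV k) h)
      rw [jV_mul_aeval, add_sub_cancel_left] at h1
      have h2 := I.mul_mem_left (aeval (jU k) (X * C (i : k))) _ h
      rw [← map_mul] at h2
      convert I.sub_mem h1 h2 using 1
      rw [← map_sub]
      congr 1
      ring
    by_cases h0 : X * (X * derivative p - C (i : k) * p) = 0
    · have h0' : X * derivative p - C (i : k) * p = 0 :=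
        (mul_eq_zero.mp h0).resolve_left X_ne_zero
      have hmon : p = monomial i (p.coeff i) := by
        ext j
        rw [coeff_monomial]
        split_ifs with hij
        · rw [hij]
        · have := hcoeff j
          rw [h0', coeff_zero] at this
          refine (mul_eq_zero.mp this.symm).resolve_left ?_
          exact sub_ne_zero.mpr (fun e => hij (Nat.cast_injective e).symm)
      refine ⟨i, ?_⟩
      have h1 := I.mul_mem_left (algebraMap k _ (p.coeff i)⁻¹) _ h
      rw [hmon, aeval_monomial, ← mul_assoc, ← map_mul, coeff_monomial, if_pos rfl,
        inv_mul_cancel₀ (mem_support_iff.mp hi), map_one, one_mul] at h1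
      exact h1
    · refine ih _ ?_ _ h0 hmem rfl
      rw [← hN]
      have hsub : (X * (X * derivative p - C (i : k) * p)).support ⊆
          (p.support.erase i).image Nat.succ := by
        intro j hj
        rw [mem_support_iff] at hj
        cases j with
        | zero => simp at hj
        | succ j =>
          rw [coeff_X_mul, hcoeff] at hj
          refine Finset.mem_image_of_mem _ (Finset.mem_erase.mpr ⟨?_, ?_⟩)
          · rintro rfl
            simp at hj
          · exact mem_support_iff.mpr (right_ne_zero_of_mul hj)
      exact (Finset.card_le_card hsub).trans_lt
        (Finset.card_image_le.trans_lt (Finset.card_erase_lt_of_mem hi))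

theorem exists_jU_pow_mem_of_ofNormalForm_mem (I : TwoSidedIdeal (JordanPlane k)) (r s : ℕ)
    (P : k[X][X]) (hP : P ≠ 0) (h : jU k ^ r * ofNormalForm P * jU k ^ s ∈ I) :
    ∃ n, jU k ^ n ∈ I := by
  induction hN : P.natDegree using Nat.strong_induction_on generalizing P r s with
  | _ N ih =>
    by_cases h0 : P.natDegree = 0
    · rw [eq_C_of_natDegree_eq_zero h0, ofNormalForm_C] at h
      rw [eq_C_of_natDegree_eq_zero h0, Ne, C_eq_zero] at hP
      refine exists_jU_pow_mem_of_aeval_mem I (X ^ r * P.coeff 0 * X ^ s)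
        (mul_ne_zero (mul_ne_zero (pow_ne_zero _ X_ne_zero) hP) (pow_ne_zero _ X_ne_zero)) ?_
      simpa only [map_mul, map_pow, aeval_X] using h
    · refine ih _ (hN ▸ natDegree_derivative_lt h0) (r + 1) (s + 1) (derivative P) ?_ ?_ rfl
      · intro hd
        exact h0 (derivative_eq_zero.mp hd)
      · convert I.sub_mem (I.mul_mem_right _ (jU k) h) (I.mul_mem_left (jU k) _ h) using 1
        have e := ofNormalForm_mul_jU P
        calc jU k ^ (r + 1) * ofNormalForm (derivative P) * jU k ^ (s + 1)
            = jU k ^ r * (jU k * ofNormalForm (derivative P) * jU k) * jU k ^ s := by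
              rw [pow_succ, pow_succ']; simp only [mul_assoc]
          _ = jU k ^ r * (ofNormalForm P * jU k - jU k * ofNormalForm P) * jU k ^ s := by
              rw [e, add_sub_cancel_left]
          _ = jU k ^ r * ofNormalForm P * (jU k * jU k ^ s) -
                (jU k ^ r * jU k) * ofNormalForm P * jU k ^ s := by
              simp only [mul_sub, sub_mul, mul_assoc]
          _ = _ := by
              rw [← pow_succ, ← pow_succ', pow_succ, pow_succ']; simp only [mul_assoc]

/-- Every nonzero ideal of the Jordan plane contains a power of `u`. -/
theorem exists_jU_pow_mem (I : TwoSidedIdeal (JordanPlane k)) (hI : ∃ x ∈ I, x ≠ 0) :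
    ∃ n, jU k ^ n ∈ I := by
  obtain ⟨x, hx, hx0⟩ := hI
  obtain ⟨P, rfl⟩ := ofNormalForm_surjective x
  refine exists_jU_pow_mem_of_ofNormalForm_mem I 0 0 P ?_ (by simpa using hx)
  rintro rfl
  exact hx0 (eval₂_zero _ _)

theorem eq_zero_of_mul_jU_pow_eq_zero (n : ℕ) (a : JordanPlane k) (h : a * jU k ^ n = 0) :
    a = 0 := by
  by_contra ha
  obtain ⟨m, hm⟩ := exists_jU_pow_mem (annihilatorOfNormal _ (exists_mul_jU_pow n))
    ⟨a, mem_annihilatorOfNormal.mpr h, ha⟩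
  rw [mem_annihilatorOfNormal, ← pow_add] at hm
  exact jU_pow_ne_zero _ hm

end CharZero

/-- The two-sided ideal `uⁿA = Auⁿ`. -/
noncomputable def powIdeal (k : Type*) [Field k] (n : ℕ) : TwoSidedIdeal (JordanPlane k) :=
  spanOfNormal (jU k ^ n) (exists_mul_jU_pow n)

theorem mem_powIdeal {n : ℕ} {x : JordanPlane k} :
    x ∈ powIdeal k n ↔ ∃ y, x = jU k ^ n * y :=
  mem_spanOfNormal

theorem exists_mem_powIdeal_ne_zero (n : ℕ) : ∃ x ∈ powIdeal k n, x ≠ 0 :=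
  ⟨jU k ^ n, mem_powIdeal.mpr ⟨1, (mul_one _).symm⟩, jU_pow_ne_zero n⟩

end JordanPlane

open JordanPlane in
/-- The symmetric Martindale ring of quotients of the Jordan plane `k_J[u,v]` is the
localisation `k_J[u,v][u⁻¹]`. -/
theorem martindaleQuotient_jordanPlane
    (k : Type) [Field k] [IsAlgClosed k] [CharZero k]
    (Q : Type) [Ring Q] (f : JordanPlane k →+* Q)
    (hloc : IsOreLocalization (Submonoid.closure {jU k}) f) :
    IsSymmetricMartindaleQuotient (JordanPlane k) Q f := by
  have hunit : ∀ n, IsUnit (f (jU k ^ n)) := fun n =>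
    hloc.isUnit _ (Submonoid.mem_closure_singleton.mpr ⟨n, rfl⟩)
  refine ⟨?_, ?_, ?_, ?_⟩
  · rw [injective_iff_map_eq_zero]
    intro a ha
    obtain ⟨s, hs, has⟩ := hloc.ker a ha
    obtain ⟨n, rfl⟩ := Submonoid.mem_closure_singleton.mp hs
    exact eq_zero_of_mul_jU_pow_eq_zero n a has
  · intro q
    obtain ⟨a, s, hs, hq⟩ := hloc.num_den q
    obtain ⟨n, rfl⟩ := Submonoid.mem_closure_singleton.mp hs
    obtain ⟨b, hb⟩ := exists_jU_pow_mul n a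
    have hq' : f (jU k ^ n) * q = f b := by
      rw [← (hunit n).mul_left_inj, mul_assoc, hq, ← map_mul, ← map_mul, hb]
    refine ⟨powIdeal k n, powIdeal k n, exists_mem_powIdeal_ne_zero n,
      exists_mem_powIdeal_ne_zero n, ?_, ?_⟩
    · intro x hx
      obtain ⟨y, rfl⟩ := mem_powIdeal.mp hx
      obtain ⟨z, hz⟩ := exists_jU_pow_mul n y
      exact ⟨z * b, by rw [hz, map_mul, map_mul, mul_assoc, hq']⟩
    · intro x hx
      obtain ⟨y, rfl⟩ := mem_powIdeal.mp hx
      exact ⟨a * y, by rw [map_mul, map_mul, ← mul_assoc, hq]⟩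
  · intro q I hI h
    obtain ⟨n, hn⟩ := exists_jU_pow_mem I hI
    rcases h with h | h
    · exact (hunit n).mul_right_eq_zero.mp (h _ hn)
    · exact (hunit n).mul_left_eq_zero.mp (h _ hn)
  · intro I J hI hJ F G _ _ _ _ hFG
    obtain ⟨n, hn⟩ := exists_jU_pow_mem I hI
    obtain ⟨m, hm⟩ := exists_jU_pow_mem J hJ
    obtain ⟨w, hw⟩ := hunit m
    have hF : ∀ a ∈ I, f (F a) = f a * (f (G (jU k ^ m)) * ↑w⁻¹) := by
      intro a ha
      rw [← mul_assoc, Units.eq_mul_inv_iff_mul_eq, hw, ← map_mul, ← map_mul, hFG a ha _ hm]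
    refine ⟨f (G (jU k ^ m)) * ↑w⁻¹, hF, fun b hb => ?_⟩
    rw [← (hunit n).mul_right_inj, ← map_mul, ← hFG _ hn b hb, map_mul, hF _ hn, mul_assoc]
end

section
/- Let k be an algebraically closed field of characteristic zero, let q ∈ k^× be a primitive kth root of unity, and let ω be a primitive nth root of unity. Let C_n = ⟨g⟩ act on the localised quantum plane A' = k_q[u^{±1}, v^{±1}] by g·u = ωu, g·v = ω^{−1}v. Then the skew group ring T' = k_q[u^{±1}, v^{±1}] # C_n is an Azumaya algebra. -/
/-- The relation defining the quantum plane `K_q[u,v]`: `v u = q · u v`. -/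
inductive QuantumRel (K : Type*) [CommRing K] (q : K) :
    FreeAlgebra K (Fin 2) → FreeAlgebra K (Fin 2) → Prop
  | rel : QuantumRel K q (FreeAlgebra.ι K 1 * FreeAlgebra.ι K 0)
      (q • (FreeAlgebra.ι K 0 * FreeAlgebra.ι K 1))

/-- The quantum plane `K_q[u,v] = K⟨u,v⟩/(vu - q·uv)`. -/
abbrev QuantumPlane (K : Type*) [CommRing K] (q : K) := RingQuot (QuantumRel K q)

/-- The generator `u` of the quantum plane. -/
noncomputable def qU (K : Type*) [CommRing K] (q : K) : QuantumPlane K q :=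
  RingQuot.mkAlgHom K (QuantumRel K q) (FreeAlgebra.ι K 0)

/-- The generator `v` of the quantum plane. -/
noncomputable def qV (K : Type*) [CommRing K] (q : K) : QuantumPlane K q :=
  RingQuot.mkAlgHom K (QuantumRel K q) (FreeAlgebra.ι K 1)

theorem azumayaMulMap_tmul (A : Type*) [Ring A] (a : A) (b : Aᵐᵒᵖ) (t : A) :
    azumayaMulMap A (TensorProduct.tmul _ a b) t = a * t * b.unop := rfl

open scoped TensorProduct in
/-- If `e t = ∑ j, x j * t * y j` takes central values and `t = ∑ i, p i * e (p' i * t)`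
for all `t`, then the ring is Azumaya over its centre. -/
theorem IsAzumayaAlgebra.of_dualBasis {T I J : Type*} [Ring T] [Fintype I] [Fintype J]
    (p p' : I → T) (x y : J → T)
    (hcentral : ∀ t, ∑ j, x j * t * y j ∈ Subring.center T)
    (hdual : ∀ t, ∑ i, p i * ∑ j, x j * (p' i * t) * y j = t) : IsAzumayaAlgebra T := by
  have smul_eq (z : Subring.center T) (t : T) : z • t = (z : T) * t := rfl
  have comm (z : Subring.center T) (t : T) : t * (z : T) = z * t :=
    Subring.mem_center_iff.mp z.2 t
  have smul_op (z : Subring.center T) (b : T) :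
      z • MulOpposite.op b = MulOpposite.op ((z : T) * b) := rfl
  let e : T →ₗ[Subring.center T] Subring.center T :=
    { toFun := fun t => ⟨∑ j, x j * t * y j, hcentral t⟩
      map_add' := fun a b => by
        ext; simp [mul_add, add_mul, Finset.sum_add_distrib]
      map_smul' := fun z t => by
        ext
        simp only [smul_eq, RingHom.id_apply, smul_eq_mul, Subring.coe_mul, Finset.mul_sum]
        refine Finset.sum_congr rfl fun j _ => ?_
        rw [← mul_assoc, comm z (x j)]
        simp only [mul_assoc] }
  have he (t : T) : (e t : T) = ∑ j, x j * t * y j := rfl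
  let split : T →ₗ[Subring.center T] (I → Subring.center T) :=
    LinearMap.pi fun i => e ∘ₗ
      { toFun := fun t => p' i * t
        map_add' := mul_add _
        map_smul' := fun z t => by
          simp only [smul_eq, RingHom.id_apply]
          rw [← mul_assoc, comm, mul_assoc] }
  have hsplit (t : T) (i : I) : split t i = e (p' i * t) := rfl
  have hcomp : (Fintype.linearCombination (Subring.center T) p) ∘ₗ split = LinearMap.id := by
    ext t
    simp only [LinearMap.comp_apply, Fintype.linearCombination_apply, hsplit, smul_eq,
      LinearMap.id_apply]
    conv_rhs => rw [← hdual t]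
    exact Finset.sum_congr rfl fun i _ => by rw [← comm, he]
  refine ⟨?_, Module.Projective.of_split _ _ hcomp, ?_, ?_⟩
  · exact Module.Finite.of_surjective (Fintype.linearCombination (Subring.center T) p)
      fun t => ⟨split t, LinearMap.congr_fun hcomp t⟩
  · rw [injective_iff_map_eq_zero]
    intro w hw
    have key (w : T ⊗[Subring.center T] Tᵐᵒᵖ) :
        w = ∑ i, ∑ j, p i ⊗ₜ[Subring.center T]
          MulOpposite.op (x j * p' i * azumayaMulMap T w (y j)) := by
      induction w using TensorProduct.induction_on with
      | zero => simp
      | add a b ha hb =>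
        simp only [map_add, LinearMap.add_apply, mul_add, MulOpposite.op_add,
          TensorProduct.tmul_add, Finset.sum_add_distrib]
        rw [← ha, ← hb]
      | tmul a b =>
        induction b using MulOpposite.rec' with
        | _ b =>
        have ha : a = ∑ i, e (p' i * a) • p i := (LinearMap.congr_fun hcomp a).symm
        conv_lhs => rw [ha, TensorProduct.sum_tmul]
        refine Finset.sum_congr rfl fun i _ => ?_
        rw [TensorProduct.smul_tmul, smul_op, he, Finset.sum_mul, Finset.op_sum,
          TensorProduct.tmul_sum]
        refine Finset.sum_congr rfl fun j _ => ?_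
        rw [azumayaMulMap_tmul]
        simp only [mul_assoc, MulOpposite.unop_op]
    rw [key w, hw]
    simp
  · intro φ
    refine ⟨∑ i, ∑ j, (φ (p i) * x j * p' i) ⊗ₜ MulOpposite.op (y j), ?_⟩
    ext t
    simp only [map_sum, LinearMap.sum_apply, azumayaMulMap_tmul, MulOpposite.unop_op]
    have ht : t = ∑ i, e (p' i * t) • p i := (LinearMap.congr_fun hcomp t).symm
    conv_rhs => rw [ht]
    simp only [map_sum, map_smul]
    refine Finset.sum_congr rfl fun i _ => ?_
    rw [smul_eq, ← comm, he, Finset.mul_sum]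
    exact Finset.sum_congr rfl fun j _ => by simp only [mul_assoc]

section Conjugation

variable {K T : Type*} [Field K] [Ring T] [Algebra K T]

/-- Conjugation by units, as a monoid homomorphism into the `K`-linear endomorphisms. -/
def conjEnd (K : Type*) {T : Type*} [Field K] [Ring T] [Algebra K T] :
    Tˣ →* Module.End K T where
  toFun w := LinearMap.mulLeft K (w : T) * LinearMap.mulRight K ((w⁻¹ : Tˣ) : T)
  map_one' := by ext; simp
  map_mul' a b := by ext; simp [mul_assoc]

theorem conjEnd_apply (w : Tˣ) (t : T) : conjEnd K w t = w * t * (w⁻¹ : Tˣ) := by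
  simp [conjEnd, mul_assoc]

theorem conjEnd_eq_smul_iff (w : Tˣ) (t : T) (c : K) :
    conjEnd K w t = c • t ↔ (w : T) * t = c • (t * w) := by
  rw [conjEnd_apply, Units.mul_inv_eq_iff_eq_mul, smul_mul_assoc]

theorem conjEnd_eq_self_iff (w : Tˣ) (t : T) : conjEnd K w t = t ↔ Commute (w : T) t := by
  rw [conjEnd_apply, Units.mul_inv_eq_iff_eq_mul]; rfl

theorem conjEnd_mul_apply (w : Tˣ) (s t : T) :
    conjEnd K w (s * t) = conjEnd K w s * conjEnd K w t := by
  simp [conjEnd_apply, mul_assoc]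

/-- `s` is an eigenvector for conjugation by `w`, with eigenvalue an `N`-th root of unity. -/
def SkewCommutes (K : Type*) {T : Type*} [Field K] [Ring T] [Algebra K T] (N : ℕ) (w : Tˣ)
    (s : T) : Prop := ∃ c : K, c ^ N = 1 ∧ conjEnd K w s = c • s

namespace SkewCommutes

variable {N : ℕ}

theorem of_commute {w : Tˣ} {s : T} (h : Commute (w : T) s) : SkewCommutes K N w s :=
  ⟨1, one_pow N, by rw [(conjEnd_eq_self_iff _ _).2 h, one_smul]⟩

theorem symm (hN : 0 < N) {a b : Tˣ} (h : SkewCommutes K N a (b : T)) :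
    SkewCommutes K N b (a : T) := by
  obtain ⟨c, hc1, hc⟩ := h
  have hc0 : c ≠ 0 := by
    rintro rfl
    simp [hN.ne'] at hc1
  refine ⟨c⁻¹, by rw [inv_pow, hc1, inv_one], ?_⟩
  rw [conjEnd_eq_smul_iff] at hc ⊢
  rw [hc, smul_smul, inv_mul_cancel₀ hc0, one_smul]

theorem mul {w : Tˣ} {s t : T} (hs : SkewCommutes K N w s)
    (ht : SkewCommutes K N w t) : SkewCommutes K N w (s * t) := by
  obtain ⟨c, hc1, hc⟩ := hs
  obtain ⟨d, hd1, hd⟩ := ht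
  exact ⟨c * d, by rw [mul_pow, hc1, hd1, one_mul],
    by rw [conjEnd_mul_apply, hc, hd, smul_mul_smul_comm]⟩

theorem pow {w : Tˣ} {s : T} (hs : SkewCommutes K N w s) (m : ℕ) :
    SkewCommutes K N w (s ^ m) := by
  induction m with
  | zero => exact of_commute (by simp)
  | succ m ih => rw [pow_succ]; exact ih.mul hs

theorem commute_pow {w : Tˣ} {s : T} (hs : SkewCommutes K N w s) :
    Commute (w : T) (s ^ N) := by
  obtain ⟨c, hc1, hc⟩ := hs
  have hp (m : ℕ) : conjEnd K w (s ^ m) = c ^ m • s ^ m := by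
    induction m with
    | zero => simp [conjEnd_apply]
    | succ m ih => rw [pow_succ, conjEnd_mul_apply, ih, hc, smul_mul_smul_comm, pow_succ]
  rw [← conjEnd_eq_self_iff (K := K), hp, hc1, one_smul]

theorem commute_conjEnd {a b : Tˣ} (h : SkewCommutes K N a (b : T)) :
    Commute (conjEnd K a) (conjEnd K b) := by
  obtain ⟨c, -, hc⟩ := h
  have hinv : c • conjEnd K a ((b⁻¹ : Tˣ) : T) = ((b⁻¹ : Tˣ) : T) := by
    rw [← Units.mul_right_inj b, mul_smul_comm, ← smul_mul_assoc, ← hc, ← conjEnd_mul_apply,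
      Units.mul_inv]
    simp [conjEnd_apply]
  ext t
  rw [Module.End.mul_apply, Module.End.mul_apply, conjEnd_apply b t, conjEnd_mul_apply,
    conjEnd_mul_apply, hc, smul_mul_assoc, smul_mul_assoc, ← mul_smul_comm, hinv, conjEnd_apply b]

end SkewCommutes

theorem conjEnd_pow_eq_one {w : Tˣ} {m : ℕ} (h : (w : T) ^ m ∈ Subring.center T) :
    conjEnd K w ^ m = 1 := by
  rw [← map_pow]
  ext t
  exact (conjEnd_eq_self_iff _ _).2 (by
    rw [Units.val_pow_eq_pow_val]; exact (Subring.mem_center_iff.mp h t).symm)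

theorem Module.End.geom_sum_apply_of_eigenvector {M : Type*} [AddCommGroup M] [Module K M]
    {φ : Module.End K M} {s : M} {c : K} (h : φ s = c • s) (N : ℕ) :
    (∑ a ∈ Finset.range N, φ ^ a) s = (∑ a ∈ Finset.range N, c ^ a) • s := by
  have hp (a : ℕ) : (φ ^ a) s = c ^ a • s := by
    induction a with
    | zero => simp
    | succ a ih => rw [pow_succ', Module.End.mul_apply, ih, map_smul, h, smul_smul, pow_succ]
  simp [hp, Finset.sum_smul]

/-- A ring whose centre is the common centraliser of three units which commute up to roots of
unity is Azumaya. -/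
theorem IsAzumayaAlgebra.of_skewCommutes [CharZero K] {x y z : Tˣ} {N : ℕ} (hN : 0 < N)
    (hyx : SkewCommutes K N y (x : T)) (hzx : SkewCommutes K N z (x : T))
    (hzy : SkewCommutes K N z (y : T))
    (hcenter : ∀ t : T, Commute (x : T) t → Commute (y : T) t → Commute (z : T) t →
      t ∈ Subring.center T) : IsAzumayaAlgebra T := by
  classical
  have hxy := hyx.symm hN
  have hxz := hzx.symm hN
  have hyz := hzy.symm hN
  have hself (w : Tˣ) : SkewCommutes K N w (w : T) := .of_commute (Commute.refl _)
  have hX := conjEnd_pow_eq_one (K := K)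
    (hcenter _ (hself x).commute_pow hyx.commute_pow hzx.commute_pow)
  have hY := conjEnd_pow_eq_one (K := K)
    (hcenter _ hxy.commute_pow (hself y).commute_pow hzy.commute_pow)
  have hZ := conjEnd_pow_eq_one (K := K)
    (hcenter _ hxz.commute_pow hyz.commute_pow (hself z).commute_pow)
  have mul_geom {φ : Module.End K T} (h : φ ^ N = 1) :
      φ * ∑ a ∈ Finset.range N, φ ^ a = ∑ a ∈ Finset.range N, φ ^ a := by
    have := mul_geom_sum φ N
    rwa [h, sub_self, sub_mul, one_mul, sub_eq_zero] at this
  set P := ∑ a ∈ Finset.range N, conjEnd K x ^ a with hP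
  set Q := ∑ a ∈ Finset.range N, conjEnd K y ^ a with hQ
  set R := ∑ a ∈ Finset.range N, conjEnd K z ^ a with hR
  have hyP : Commute (conjEnd K y) P :=
    Commute.sum_right _ _ _ fun a _ => hyx.commute_conjEnd.pow_right a
  have hzP : Commute (conjEnd K z) P :=
    Commute.sum_right _ _ _ fun a _ => hzx.commute_conjEnd.pow_right a
  have hzQ : Commute (conjEnd K z) Q :=
    Commute.sum_right _ _ _ fun a _ => hzy.commute_conjEnd.pow_right a
  have hxE : conjEnd K x * (P * Q * R) = P * Q * R := by
    rw [← mul_assoc, ← mul_assoc, mul_geom hX]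
  have hyE : conjEnd K y * (P * Q * R) = P * Q * R := by
    rw [← mul_assoc, ← mul_assoc, hyP.eq, mul_assoc P, mul_geom hY]
  have hzE : conjEnd K z * (P * Q * R) = P * Q * R := by
    rw [← mul_assoc, (hzP.mul_right hzQ).eq, mul_assoc, mul_geom hZ]
  have hE (t : T) : (P * Q * R) t ∈ Subring.center T := by
    refine hcenter _ ?_ ?_ ?_ <;> rw [← conjEnd_eq_self_iff (K := K), ← Module.End.mul_apply]
    · rw [hxE]
    · rw [hyE]
    · rw [hzE]
  let w : Fin N × Fin N × Fin N → Tˣ := fun i => x ^ (i.1 : ℕ) * y ^ (i.2.1 : ℕ) * z ^ (i.2.2 : ℕ)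
  have hEw (t : T) : (P * Q * R) t = ∑ i, (w i : T) * t * ((w i)⁻¹ : Tˣ) := by
    have hsum : P * Q * R = ∑ i, conjEnd K (w i) := by
      simp only [hP, hQ, hR, Finset.sum_range, w, map_mul, map_pow, Fintype.sum_prod_type]
      rw [Finset.sum_mul_sum, Finset.sum_mul]
      exact Finset.sum_congr rfl fun _ _ => Finset.sum_mul_sum _ _ _ _
    simp [hsum, conjEnd_apply]
  have hskew (i) : ∃ c : K, (P * Q * R) (w i : T) = c • (w i : T) := by
    have aux {u : Tˣ} (h1 : SkewCommutes K N u (x : T)) (h2 : SkewCommutes K N u (y : T))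
        (h3 : SkewCommutes K N u (z : T)) : SkewCommutes K N u (w i : T) := by
      simp only [w, Units.val_mul, Units.val_pow_eq_pow_val]
      exact ((h1.pow _).mul (h2.pow _)).mul (h3.pow _)
    obtain ⟨c, -, hc⟩ := aux (hself x) hxy hxz
    obtain ⟨d, -, hd⟩ := aux hyx (hself y) hyz
    obtain ⟨e, -, he⟩ := aux hzx hzy (hself z)
    rw [Module.End.mul_apply, Module.End.mul_apply,
      Module.End.geom_sum_apply_of_eigenvector he, map_smul,
      Module.End.geom_sum_apply_of_eigenvector hd, map_smul, map_smul,
      Module.End.geom_sum_apply_of_eigenvector hc, smul_smul, smul_smul]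
    exact ⟨_, rfl⟩
  let m : Fin N × Fin N × Fin N → ℕ := fun i =>
    if (w i : T) ∈ Subring.center T then Fintype.card (Fin N × Fin N × Fin N) else 0
  have hterm (i) (t : T) :
      (P * Q * R) (w i : T) * t * ((w i)⁻¹ : Tˣ) = (m i : K) • t := by
    by_cases hi : (w i : T) ∈ Subring.center T
    · have hw : (P * Q * R) (w i : T) =
          (Fintype.card (Fin N × Fin N × Fin N) : K) • (w i : T) := by
        rw [hEw]
        simp only [Subring.mem_center_iff.mp hi, mul_assoc, Units.mul_inv, mul_one]
        rw [Finset.sum_const, Finset.card_univ, Nat.cast_smul_eq_nsmul]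
      simp only [m, if_pos hi]
      rw [hw, smul_mul_assoc, smul_mul_assoc, ← Subring.mem_center_iff.mp hi t, mul_assoc,
        Units.mul_inv, mul_one]
    · obtain ⟨c, hc⟩ := hskew i
      have hc0 : c = 0 := by
        by_contra hc0
        refine hi ?_
        have : (w i : T) = (P * Q * R) (c⁻¹ • (w i : T)) := by
          rw [map_smul, hc, smul_smul, inv_mul_cancel₀ hc0, one_smul]
        rw [this]
        exact hE _
      simp [m, if_neg hi, hc, hc0]
  have hm : ((∑ i, m i : ℕ) : K) ≠ 0 := by
    rw [Nat.cast_ne_zero, ← Nat.pos_iff_ne_zero]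
    have : NeZero N := ⟨hN.ne'⟩
    refine Finset.sum_pos' (fun _ _ => Nat.zero_le _) ⟨(0, 0, 0), Finset.mem_univ _, ?_⟩
    have : (w (0, 0, 0) : T) ∈ Subring.center T := by simp [w, one_mem]
    simp only [m, if_pos this]
    exact Fintype.card_pos
  refine .of_dualBasis (fun i => (w i : T))
    (fun i => ((∑ i, m i : ℕ) : K)⁻¹ • (((w i)⁻¹ : Tˣ) : T)) (fun i => (w i : T))
    (fun i => (((w i)⁻¹ : Tˣ) : T)) (fun t => hEw t ▸ hE t) fun t => ?_
  simp only [Finset.mul_sum]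
  rw [Finset.sum_comm]
  have hj (j) : ∑ i, (w i : T) * ((w j : T) * (((∑ i, m i : ℕ) : K)⁻¹ •
      (((w i)⁻¹ : Tˣ) : T) * t) * (((w j)⁻¹ : Tˣ) : T)) =
      ((∑ i, m i : ℕ) : K)⁻¹ • (m j : K) • t := by
    rw [← hterm, hEw, Finset.sum_mul, Finset.sum_mul, Finset.smul_sum]
    exact Finset.sum_congr rfl fun i _ => by
      simp only [smul_mul_assoc, mul_smul_comm, mul_assoc]
  simp only [hj]
  rw [← Finset.smul_sum, ← Finset.sum_smul, ← Nat.cast_sum, smul_smul, inv_mul_cancel₀ hm,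
    one_smul]

end Conjugation

theorem IsOreLocalization.commute_of_commute_map {A B C : Type*} [Ring A] [Ring B] [Ring C]
    {S : Submonoid A} {f : A →+* B} (h : IsOreLocalization S f) (φ : B →+* C) {t : C}
    (ht : ∀ a, Commute (φ (f a)) t) (b : B) : Commute (φ b) t := by
  obtain ⟨a, s, hs, hb⟩ := h.num_den b
  refine ((h.isUnit s hs).map φ).mul_right_cancel ?_
  rw [mul_assoc, ← (ht s).eq, ← mul_assoc, ← map_mul, hb, (ht a).eq, mul_assoc, ← map_mul, hb]

theorem QuantumPlane.qV_mul_qU (K : Type*) [CommRing K] (q : K) :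
    qV K q * qU K q = q • (qU K q * qV K q) := by
  simp only [qU, qV, ← map_mul, ← map_smul]
  exact RingQuot.mkAlgHom_rel K QuantumRel.rel

/-- Elements commuting with scalars and with the generators commute with the quantum plane. -/
theorem QuantumPlane.commute_map {K : Type*} [CommRing K] {q : K} {T : Type*} [Ring T]
    (φ : QuantumPlane K q →+* T) {t : T} (hK : ∀ c : K, Commute (φ (algebraMap K _ c)) t)
    (hu : Commute (φ (qU K q)) t) (hv : Commute (φ (qV K q)) t) (a : QuantumPlane K q) :
    Commute (φ a) t := by
  obtain ⟨a, rfl⟩ := RingQuot.mkAlgHom_surjective K (QuantumRel K q) a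
  induction a using FreeAlgebra.induction with
  | grade0 c => rw [AlgHom.commutes]; exact hK c
  | grade1 i =>
    fin_cases i
    · exact hu
    · exact hv
  | mul a b ha hb => rw [map_mul, map_mul]; exact ha.mul_left hb
  | add a b ha hb => rw [map_add, map_add]; exact ha.add_left hb

/-- If `q` is a root of unity, the skew group ring `k_q[u^{±1},v^{±1}] # C_n` is Azumaya. -/
theorem localizedQuantumPlane_skewGroupRing_azumaya
    (k : Type) [Field k] [IsAlgClosed k] [CharZero k]
    (r : ℕ) (hr : 0 < r) (q : k) (hq : IsPrimitiveRoot q r)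
    (n : ℕ) (hn : 0 < n) (ω : k) (hω : IsPrimitiveRoot ω n)
    (G : Type) [Group G] [Fintype G] (g : G)
    (hord : orderOf g = n) (hcyc : ∀ x : G, ∃ i : ℕ, x = g ^ i)
    [MulSemiringAction G (QuantumPlane k q)] [SMulCommClass G k (QuantumPlane k q)]
    (hgu : g • qU k q = ω • qU k q) (hgv : g • qV k q = ω⁻¹ • qV k q)
    (A' : Type) [Ring A'] (f : QuantumPlane k q →+* A')
    (hloc : IsOreLocalization (Submonoid.closure {qU k q, qV k q}) f)
    [MulSemiringAction G A']
    (hequi : ∀ (x : G) (a : QuantumPlane k q), x • f a = f (x • a))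
    (T' : Type) [Ring T'] (iota : A' →+* T') (j : G → T')
    (hT : IsSkewGroupRing A' G T' iota j) :
    IsAzumayaAlgebra T' := by
  have hAcomm (c : k) (b : A') : Commute b (f (algebraMap k _ c)) :=
    hloc.commute_of_commute_map (RingHom.id A')
      (fun a => Commute.map (Algebra.commutes c a).symm f) b
  have hfix (x : G) (c : k) :
      x • f (algebraMap k (QuantumPlane k q) c) = f (algebraMap k _ c) := by
    rw [hequi, Algebra.algebraMap_eq_smul_one, smul_comm, smul_one]
  have commute_of {t : T'} (hA : ∀ b, Commute (iota b) t) (hj : ∀ x, Commute (j x) t) (s : T') :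
      Commute s t := by
    obtain ⟨c, hc, -⟩ := hT.basis s
    rw [hc]
    exact Commute.sum_left _ _ _ fun x _ => (hA _).mul_left (hj x)
  let φ : k →+* T' := iota.comp (f.comp (algebraMap k _))
  have hφ (c : k) (s : T') : Commute s (φ c) := by
    refine commute_of (fun b => (hAcomm c b).map iota) (fun x => ?_) s
    have := hT.comm x (f (algebraMap k _ c))
    rwa [hfix] at this
  let _ : Algebra k T' := φ.toAlgebra' fun c s => (hφ c s).symm.eq
  have smul_def (c : k) (s : T') : c • s = φ c * s := rfl
  have hmap (c : k) (a : QuantumPlane k q) : iota (f (c • a)) = c • iota (f a) := by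
    rw [smul_def, Algebra.smul_def, map_mul, map_mul]; rfl
  obtain ⟨x, hx⟩ := (hloc.isUnit _ (Submonoid.subset_closure (Or.inl rfl))).map iota
  obtain ⟨y, hy⟩ := (hloc.isUnit _ (Submonoid.subset_closure (Or.inr rfl))).map iota
  let z : T'ˣ := ⟨j g, j g⁻¹, by rw [hT.j_mul, mul_inv_cancel, hT.j_one],
    by rw [hT.j_mul, inv_mul_cancel, hT.j_one]⟩
  have hz : (z : T') = j g := rfl
  refine IsAzumayaAlgebra.of_skewCommutes (K := k) (x := x) (y := y) (z := z) (N := r * n)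
    (Nat.mul_pos hr hn) ⟨q, by rw [pow_mul, hq.pow_eq_one, one_pow], ?_⟩
    ⟨ω, by rw [mul_comm, pow_mul, hω.pow_eq_one, one_pow], ?_⟩
    ⟨ω⁻¹, by rw [mul_comm, pow_mul, inv_pow, hω.pow_eq_one, inv_one, one_pow], ?_⟩ ?_
  · rw [conjEnd_eq_smul_iff, hx, hy, ← map_mul, ← map_mul, QuantumPlane.qV_mul_qU, hmap,
      map_mul, map_mul]
  · rw [conjEnd_eq_smul_iff, hx, hz, hT.comm, hequi, hgu, hmap, smul_mul_assoc]
  · rw [conjEnd_eq_smul_iff, hy, hz, hT.comm, hequi, hgv, hmap, smul_mul_assoc]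
  · intro t htx hty htz
    rw [hx] at htx
    rw [hy] at hty
    have hf (a : QuantumPlane k q) : Commute (iota (f a)) t :=
      QuantumPlane.commute_map (iota.comp f) (fun c => (hφ c t).symm) htx hty a
    have hA := hloc.commute_of_commute_map iota hf
    have hG (x : G) : Commute (j x) t := by
      obtain ⟨i, rfl⟩ := hcyc x
      induction i with
      | zero => rw [pow_zero, hT.j_one]; exact Commute.one_left t
      | succ i ih => rw [pow_succ, ← hT.j_mul]; exact ih.mul_left htz
    exact Subring.mem_center_iff.mpr fun s => (commute_of hA hG s).eq
end
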